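/- arXiv:2007.05705 — 16 statements merged into one kernel-verified Lean document; each statement's English description precedes it below -/
import Mathlib

section
/- Let I be a nonempty index set and let γ_ij, (i,j) ∈ I×I, be a family of class-K functions. Then sup_{i,j∈I} γ_ij(r) < ∞ for every r ≥ 0 if and only if there exist a function ζ of class K∞ and a constant a ≥ 0 such that sup_{i,j∈I} γ_ij(r) ≤ a + ζ(r) for all r ≥ 0. -/
open Filter Set

noncomputable section

/-- A function of class `K`: continuous on `[0,∞)`, strictly increasing on `[0,∞)`,
and vanishing at `0`. -/
def IsClassK (γ : ℝ → ℝ) : Prop :=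
  ContinuousOn γ (Set.Ici 0) ∧ StrictMonoOn γ (Set.Ici 0) ∧ γ 0 = 0

/-- A function of class `K∞`: class `K` and unbounded. -/
def IsClassKInf (γ : ℝ → ℝ) : Prop :=
  IsClassK γ ∧ Filter.Tendsto γ Filter.atTop Filter.atTop

/-- A function of class `K ∪ {0}`: either of class `K` or identically zero on `[0,∞)`. -/
def IsClassK0 (γ : ℝ → ℝ) : Prop :=
  IsClassK γ ∨ Set.EqOn γ 0 (Set.Ici 0)

/-- For a family `γ i j` of class-`K` functions over a nonempty index set `I`,
`sup_{i,j} γ_ij(r) < ∞` for every `r ≥ 0` iff there are `ζ ∈ K∞` and `a ≥ 0` with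
`sup_{i,j} γ_ij(r) ≤ a + ζ(r)` for all `r ≥ 0`. -/
theorem sup_gains_finite_iff_affine_Kinf_bound
    {I : Type*} [Nonempty I] (γ : I → I → ℝ → ℝ)
    (hγ : ∀ i j, IsClassK (γ i j)) :
    (∀ r : ℝ, 0 ≤ r → BddAbove (Set.range fun p : I × I => γ p.1 p.2 r)) ↔
      ∃ ζ : ℝ → ℝ, ∃ a : ℝ, IsClassKInf ζ ∧ 0 ≤ a ∧
        ∀ r : ℝ, 0 ≤ r → ∀ i j, γ i j r ≤ a + ζ r := by
  constructor
  · intro hb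
    set S : ℝ → ℝ := fun r => sSup (Set.range fun p : I × I => γ p.1 p.2 (max r 0)) with hS
    have hle : ∀ r : ℝ, ∀ i j, γ i j (max r 0) ≤ S r := fun r i j =>
      le_csSup (hb _ (le_max_right _ _)) ⟨(i, j), rfl⟩
    have hmono : Monotone S := by
      intro x y hxy
      apply csSup_le (Set.range_nonempty _)
      rintro _ ⟨p, rfl⟩
      refine le_trans ?_ (hle y p.1 p.2)
      exact (hγ p.1 p.2).2.1.monotoneOn (le_max_right x 0) (le_max_right y 0)
        (max_le_max_right 0 hxy)
    have hnn : ∀ r, 0 ≤ S r := by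
      intro r
      obtain ⟨i⟩ := ‹Nonempty I›
      refine le_trans ?_ (hle r i i)
      have := (hγ i i).2.1.monotoneOn (Set.mem_Ici.2 le_rfl) (Set.mem_Ici.2 (le_max_right r 0))
        (le_max_right r 0)
      rwa [(hγ i i).2.2] at this
    have hint : ∀ a b, IntervalIntegrable S MeasureTheory.volume a b := fun a b =>
      hmono.intervalIntegrable
    have hsh : ∀ r, Monotone (fun u => S (u + r)) := fun r x y h => hmono (by linarith)
    set F : ℝ → ℝ := fun r => ∫ u in (0:ℝ)..1, S (u + r) with hF
    have hFm : Monotone F := by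
      intro x y hxy
      apply intervalIntegral.integral_mono_on zero_le_one
      · exact (hsh x).intervalIntegrable
      · exact (hsh y).intervalIntegrable
      · intro u _
        exact hmono (by linarith)
    have hFS : ∀ r, S r ≤ F r := by
      intro r
      have : ∫ u in (0:ℝ)..1, S r ≤ F r := by
        apply intervalIntegral.integral_mono_on zero_le_one
        · simp
        · exact (hsh r).intervalIntegrable
        · intro u hu
          exact hmono (by linarith [hu.1])
      simpa using this
    have hFc : Continuous F := by
      have h1 : Continuous (fun r => ∫ u in (0:ℝ)..r, S u) :=
        intervalIntegral.continuous_primitive hint 0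
      have h2 : F = fun r => (∫ u in (0:ℝ)..(1 + r), S u) - ∫ u in (0:ℝ)..r, S u := by
        funext r
        rw [intervalIntegral.integral_interval_sub_left (hint _ _) (hint _ _)]
        simp [hF]
      rw [h2]
      exact (h1.comp (by fun_prop : Continuous fun r : ℝ => 1 + r)).sub h1
    refine ⟨fun r => r + (F r - F 0), F 0, ⟨⟨by fun_prop, ?_, by simp⟩, ?_⟩,
      (hnn 0).trans (hFS 0), ?_⟩
    · intro x _ y _ hxy
      have := hFm hxy.le
      show x + (F x - F 0) < y + (F y - F 0)
      linarith
    · apply tendsto_atTop_mono' _ _ tendsto_id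
      filter_upwards [eventually_ge_atTop 0] with r hr
      have := hFm hr
      simp only [id]
      linarith
    · intro r hr i j
      have h1 := hle r i j
      rw [max_eq_left hr] at h1
      have h2 := hFS r
      show _ ≤ F 0 + (r + (F r - F 0))
      linarith
  · rintro ⟨ζ, a, _, _, h⟩ r hr
    refine ⟨a + ζ r, ?_⟩
    rintro _ ⟨p, rfl⟩
    exact h r hr p.1 p.2
end
end

section
/- Let I be a nonempty index set and γ_ij, (i,j) ∈ I×I, functions of class K ∪ {0}. If the family {γ_ij}_{(i,j)∈I×I} is pointwise equicontinuous (for every r ≥ 0 and ε > 0 there exists δ > 0 such that |γ_ij(r) − γ_ij(s)| ≤ ε for all (i,j) ∈ I×I whenever |r − s| ≤ δ), then the gain operator Γ_⊗ is well-defined (i.e., sup_{i,j∈I} γ_ij(r) < ∞ for all r > 0, so that Γ_⊗ maps ℓ∞(I)⁺ into ℓ∞(I)⁺) and Γ_⊗ is continuous with respect to the supremum norm. -/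
open Filter Set

noncomputable section

/-- Membership in the positive cone `ℓ∞(I)⁺` of the space of bounded real-valued
functions on `I`: componentwise nonnegative and bounded. -/
def InLinfPos {I : Type*} (x : I → ℝ) : Prop :=
  (∀ i, 0 ≤ x i) ∧ BddAbove (Set.range fun i => |x i|)

/-- The supremum norm on bounded real-valued functions on `I`. -/
def supNorm {I : Type*} (x : I → ℝ) : ℝ := ⨆ i, |x i|

/-- The max-form gain operator `Γ_⊗(x)_i = sup_j γ_ij(x_j)`. -/
def gainOpMax {I : Type*} (γ : I → I → ℝ → ℝ) (x : I → ℝ) : I → ℝ :=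
  fun i => ⨆ j, γ i j (x j)

theorem aux_K0 {g : ℝ → ℝ} (h : IsClassK0 g) :
    g 0 = 0 ∧ ∀ r s, 0 ≤ r → r ≤ s → g r ≤ g s := by
  rcases h with ⟨_, hm, h0⟩ | h
  · exact ⟨h0, fun r s hr hrs => hm.monotoneOn hr (hr.trans hrs) hrs⟩
  · refine ⟨h (Set.mem_Ici.2 le_rfl), fun r s hr hrs => ?_⟩
    rw [h (Set.mem_Ici.2 hr), h (Set.mem_Ici.2 (hr.trans hrs))]
    simp

theorem aux_unif {I : Type*} (γ : I → I → ℝ → ℝ)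
    (hequi : ∀ r : ℝ, 0 ≤ r → ∀ ε : ℝ, 0 < ε → ∃ δ : ℝ, 0 < δ ∧
      ∀ i j, ∀ s : ℝ, 0 ≤ s → |r - s| ≤ δ → |γ i j r - γ i j s| ≤ ε)
    (R ε : ℝ) (hε : 0 < ε) : ∃ δ : ℝ, 0 < δ ∧ ∀ i j, ∀ r s : ℝ, 0 ≤ r → r ≤ R → 0 ≤ s →
      |r - s| ≤ δ → |γ i j r - γ i j s| ≤ ε := by
  have H : ∀ r : Set.Icc (0:ℝ) R, ∃ δ : ℝ, 0 < δ ∧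
      ∀ i j, ∀ s : ℝ, 0 ≤ s → |r - s| ≤ δ → |γ i j r - γ i j s| ≤ ε / 2 :=
    fun r => hequi r r.2.1 _ (half_pos hε)
  choose d hd hd2 using H
  obtain ⟨δ, hδ, hL⟩ := lebesgue_number_lemma_of_metric (isCompact_Icc (a := (0:ℝ)) (b := R))
    (c := fun r : Set.Icc (0:ℝ) R => Metric.ball (r : ℝ) (d r))
    (fun r => Metric.isOpen_ball)
    (fun x hx => Set.mem_iUnion.2 ⟨⟨x, hx⟩, Metric.mem_ball_self (hd _)⟩)
  refine ⟨δ / 2, half_pos hδ, fun i j r s hr hrR hs hrs => ?_⟩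
  obtain ⟨c, hc⟩ := hL r ⟨hr, hrR⟩
  have h1 := hc (Metric.mem_ball_self hδ)
  have h2 : s ∈ Metric.ball r δ := by
    rw [Metric.mem_ball, dist_comm, Real.dist_eq]; linarith
  have h2 := hc h2
  rw [Metric.mem_ball, dist_comm, Real.dist_eq] at h1 h2
  have a1 := hd2 c i j r hr h1.le
  have a2 := hd2 c i j s hs h2.le
  rw [abs_le] at *
  constructor <;> linarith

theorem aux_bdd {I : Type*} (γ : I → I → ℝ → ℝ)
    (hγ : ∀ i j, IsClassK0 (γ i j))
    (hequi : ∀ r : ℝ, 0 ≤ r → ∀ ε : ℝ, 0 < ε → ∃ δ : ℝ, 0 < δ ∧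
      ∀ i j, ∀ s : ℝ, 0 ≤ s → |r - s| ≤ δ → |γ i j r - γ i j s| ≤ ε)
    (R : ℝ) : ∃ C : ℝ, ∀ i j, ∀ r, 0 ≤ r → r ≤ R → γ i j r ≤ C := by
  obtain ⟨δ, hδ, h⟩ := aux_unif γ hequi R 1 one_pos
  obtain ⟨n, hn⟩ := exists_nat_ge (R / δ)
  have key : ∀ n : ℕ, ∀ i j, ∀ r, 0 ≤ r → r ≤ R → r ≤ n * δ → γ i j r ≤ n := by
    intro n
    induction n with
    | zero =>
      intro i j r hr _ hr2
      have : r = 0 := by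
        apply le_antisymm _ hr
        simpa using hr2
      rw [this, (aux_K0 (hγ i j)).1]; simp
    | succ k ih =>
      intro i j r hr hrR hr2
      push_cast at hr2 ⊢
      have hk : 0 ≤ (k:ℝ) * δ := by positivity
      have hs : max 0 (r - δ) ≤ r := max_le hr (by linarith)
      have a1 := ih i j (max 0 (r - δ)) (le_max_left _ _) (hs.trans hrR)
        (max_le hk (by linarith))
      have a2 := h i j r (max 0 (r - δ)) hr hrR (le_max_left _ _) (by
        rw [abs_le]; constructor <;> linarith [le_max_right 0 (r - δ)])
      have := (abs_le.1 a2).2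
      linarith
  refine ⟨n, fun i j r hr hrR => key n i j r hr hrR ?_⟩
  rw [div_le_iff₀ hδ] at hn
  linarith

theorem aux_sup {I : Type*} [Nonempty I] {a b : I → ℝ} {ε : ℝ} (hb : BddAbove (Set.range b))
    (h : ∀ j, |a j - b j| ≤ ε) : (⨆ j, a j) - (⨆ j, b j) ≤ ε := by
  have : (⨆ j, a j) ≤ (⨆ j, b j) + ε := ciSup_le fun j => by
    linarith [le_ciSup hb j, (abs_le.1 (h j)).2]
  linarith

/-- If the family of gains `{γ_ij}` of class `K ∪ {0}` is pointwise
equicontinuous, then the gain operator `Γ_⊗` is well-defined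
(`sup_{i,j} γ_ij(r) < ∞` for all `r > 0` and `Γ_⊗` maps `ℓ∞(I)⁺` into `ℓ∞(I)⁺`)
and continuous with respect to the supremum norm. -/
theorem gainOpMax_wellDefined_and_continuous_of_equicontinuous
    {I : Type*} [Nonempty I] (γ : I → I → ℝ → ℝ)
    (hγ : ∀ i j, IsClassK0 (γ i j))
    (hequi : ∀ r : ℝ, 0 ≤ r → ∀ ε : ℝ, 0 < ε → ∃ δ : ℝ, 0 < δ ∧
      ∀ i j, ∀ s : ℝ, 0 ≤ s → |r - s| ≤ δ → |γ i j r - γ i j s| ≤ ε) :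
    (∀ r : ℝ, 0 < r → BddAbove (Set.range fun p : I × I => γ p.1 p.2 r)) ∧
    (∀ x : I → ℝ, InLinfPos x →
      (∀ i, BddAbove (Set.range fun j => γ i j (x j))) ∧
      InLinfPos (gainOpMax γ x)) ∧
    (∀ x : I → ℝ, InLinfPos x → ∀ ε : ℝ, 0 < ε → ∃ δ : ℝ, 0 < δ ∧
      ∀ y : I → ℝ, InLinfPos y → supNorm (fun i => x i - y i) ≤ δ →
        supNorm (fun i => gainOpMax γ x i - gainOpMax γ y i) ≤ ε) := by
  have B1 : ∀ x : I → ℝ, InLinfPos x → ∃ C, ∀ i j, γ i j (x j) ≤ C := by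
    rintro x ⟨hx, M, hM⟩
    obtain ⟨C, hC⟩ := aux_bdd γ hγ hequi M
    exact ⟨C, fun i j => hC i j _ (hx j) ((le_abs_self _).trans (hM ⟨j, rfl⟩))⟩
  have B2 : ∀ x : I → ℝ, InLinfPos x → ∀ i, BddAbove (Set.range fun j => γ i j (x j)) := by
    intro x hx i
    obtain ⟨C, hC⟩ := B1 x hx
    refine ⟨C, ?_⟩
    rintro _ ⟨j, rfl⟩
    exact hC i j
  refine ⟨?_, ?_, ?_⟩
  · intro r hr
    obtain ⟨C, hC⟩ := aux_bdd γ hγ hequi r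
    refine ⟨C, ?_⟩
    rintro _ ⟨p, rfl⟩
    exact hC p.1 p.2 r hr.le le_rfl
  · intro x hx
    have hnn : ∀ i, 0 ≤ gainOpMax γ x i := fun i => Real.iSup_nonneg fun j => by
      obtain ⟨h0, hm⟩ := aux_K0 (hγ i j)
      rw [← h0]
      exact hm _ _ le_rfl (hx.1 j)
    refine ⟨B2 x hx, hnn, ?_⟩
    obtain ⟨C, hC⟩ := B1 x hx
    refine ⟨C, ?_⟩
    rintro _ ⟨i, rfl⟩
    simp only [abs_of_nonneg (hnn i)]
    exact ciSup_le (hC i)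
  · intro x hx ε hε
    obtain ⟨M, hM⟩ := hx.2
    obtain ⟨δ, hδ, h⟩ := aux_unif γ hequi M ε hε
    refine ⟨δ, hδ, fun y hy hxy => ?_⟩
    obtain ⟨N, hN⟩ := hy.2
    have hb : BddAbove (Set.range fun i => |x i - y i|) := by
      refine ⟨M + N, ?_⟩
      rintro _ ⟨i, rfl⟩
      exact (abs_sub _ _).trans (add_le_add (hM ⟨i, rfl⟩) (hN ⟨i, rfl⟩))
    have hd : ∀ i j, |γ i j (x j) - γ i j (y j)| ≤ ε := fun i j =>
      h i j _ _ (hx.1 j) ((le_abs_self _).trans (hM ⟨j, rfl⟩)) (hy.1 j)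
        ((le_ciSup hb j).trans hxy)
    refine ciSup_le fun i => ?_
    have a1 := aux_sup (B2 y hy i) (hd i)
    have a2 := aux_sup (B2 x hx i) (fun j => (abs_sub_comm _ _).trans_le (hd i j))
    simp only [gainOpMax]
    rw [abs_le]
    constructor <;> linarith
end
end

section
/- Let I be a nonempty countable index set and γ_ij, (i,j) ∈ I×I, functions of class K ∪ {0} such that the operator Γ_⊞ is well-defined. If each γ_ij is continuously differentiable on (0,∞) and sup_{i∈I} Σ_{j∈I} sup_{0 < s ≤ r} γ_ij'(s) < ∞ for every r > 0, then Γ_⊞ is continuous with respect to the supremum norm. -/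
open Filter Set

noncomputable section

/-- The summation-form gain operator `Γ_⊞(x)_i = Σ_j γ_ij(x_j)`. -/
def gainOpSum {I : Type*} (γ : I → I → ℝ → ℝ) (x : I → ℝ) : I → ℝ :=
  fun i => ∑' j, γ i j (x j)

/-- For a countable index set `I` and gains `γ_ij ∈ K ∪ {0}` such that `Γ_⊞`
is well-defined, if each `γ_ij` is `C¹` on `(0,∞)` and
`sup_i Σ_j sup_{0<s≤r} γ_ij'(s) < ∞` for every `r > 0`, then `Γ_⊞` is continuous
with respect to the supremum norm. -/
theorem gainOpSum_continuous_of_C1_derivative_bound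
    {I : Type*} [Nonempty I] [Countable I] (γ : I → I → ℝ → ℝ)
    (hγ : ∀ i j, IsClassK0 (γ i j))
    (hwd : ∀ r : ℝ, 0 < r → (∀ i, Summable fun j => γ i j r) ∧
      BddAbove (Set.range fun i => ∑' j, γ i j r))
    (hC1 : ∀ i j, ContDiffOn ℝ 1 (γ i j) (Set.Ioi 0))
    (hderiv : ∀ r : ℝ, 0 < r →
      (∀ i j, BddAbove (Set.range fun s : Set.Ioc (0:ℝ) r => deriv (γ i j) s)) ∧
      (∀ i, Summable fun j => ⨆ s : Set.Ioc (0:ℝ) r, deriv (γ i j) s) ∧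
      BddAbove (Set.range fun i => ∑' j, ⨆ s : Set.Ioc (0:ℝ) r, deriv (γ i j) s)) :
    ∀ x : I → ℝ, InLinfPos x → ∀ ε : ℝ, 0 < ε → ∃ δ : ℝ, 0 < δ ∧
      ∀ y : I → ℝ, InLinfPos y → supNorm (fun i => x i - y i) ≤ δ →
        supNorm (fun i => gainOpSum γ x i - gainOpSum γ y i) ≤ ε := by
  intro x hx ε hε
  obtain ⟨B, hB⟩ := hx.2
  have hxB : ∀ i, x i ≤ B := fun i => (le_abs_self _).trans (hB ⟨i, rfl⟩)
  obtain ⟨i0⟩ := (inferInstance : Nonempty I)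
  have hB0 : 0 ≤ B := (hx.1 i0).trans (hxB i0)
  have hr : 0 < B + 1 := by linarith
  obtain ⟨h1, h2, ⟨M, hM⟩⟩ := hderiv (B + 1) hr
  have hs := (hwd (B + 1) hr).1
  have hmono : ∀ i j, MonotoneOn (γ i j) (Set.Ici 0) := by
    intro i j
    rcases hγ i j with h | h
    · exact h.2.1.monotoneOn
    · intro a ha b hb _
      rw [h ha, h hb]; exact le_refl _
  have hcont : ∀ i j, ContinuousOn (γ i j) (Set.Ici 0) := by
    intro i j
    rcases hγ i j with h | h
    · exact h.1
    · exact continuousOn_const.congr h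
  have hzero : ∀ i j, γ i j 0 = 0 := by
    intro i j
    rcases hγ i j with h | h
    · exact h.2.2
    · exact h (Set.mem_Ici.2 le_rfl)
  set L : I → I → ℝ := fun i j => ⨆ s : Set.Ioc (0:ℝ) (B + 1), deriv (γ i j) s with hL
  have hmv : ∀ i j a b, 0 ≤ a → a ≤ b → b ≤ B + 1 → γ i j b - γ i j a ≤ L i j * (b - a) := by
    intro i j a b ha hab hb
    refine Convex.image_sub_le_mul_sub_of_deriv_le (convex_Icc a b)
      ((hcont i j).mono fun z hz => ha.trans hz.1) ?_ ?_ a ⟨le_rfl, hab⟩ b ⟨hab, le_rfl⟩ hab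
    · rw [interior_Icc]
      exact ((hC1 i j).differentiableOn one_ne_zero).mono fun z hz => lt_of_le_of_lt ha hz.1
    · rw [interior_Icc]
      intro z hz
      exact le_ciSup (h1 i j) ⟨z, lt_of_le_of_lt ha hz.1, hz.2.le.trans hb⟩
  have hL0 : ∀ i j, 0 ≤ L i j := by
    intro i j
    have := hmv i j 0 (B + 1) le_rfl hr.le le_rfl
    have h' := hmono i j (Set.mem_Ici.2 le_rfl) (Set.mem_Ici.2 hr.le) hr.le
    by_contra hn
    push Not at hn
    nlinarith
  have habs : ∀ i j a b, 0 ≤ a → 0 ≤ b → a ≤ B + 1 → b ≤ B + 1 →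
      |γ i j a - γ i j b| ≤ L i j * |a - b| := by
    intro i j a b ha hb ha' hb'
    rcases le_total a b with h | h
    · rw [abs_sub_comm, abs_sub_comm a, abs_of_nonneg (sub_nonneg.2 (hmono i j ha hb h)),
        abs_of_nonneg (sub_nonneg.2 h)]
      exact hmv i j a b ha h hb'
    · rw [abs_of_nonneg (sub_nonneg.2 (hmono i j hb ha h)), abs_of_nonneg (sub_nonneg.2 h)]
      exact hmv i j b a hb h ha'
  have hsum : ∀ z : I → ℝ, (∀ j, 0 ≤ z j) → (∀ j, z j ≤ B + 1) →
      ∀ i, Summable fun j => γ i j (z j) := by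
    intro z hz hz' i
    refine Summable.of_nonneg_of_le (fun j => ?_) (fun j => ?_) (hs i)
    · rw [← hzero i j]
      exact hmono i j (Set.mem_Ici.2 le_rfl) (hz j) (hz j)
    · exact hmono i j (hz j) (Set.mem_Ici.2 hr.le) (hz' j)
  have hM' : ∀ i, ∑' j, L i j ≤ M := fun i => hM ⟨i, rfl⟩
  have hM0 : 0 ≤ M := (tsum_nonneg (hL0 i0)).trans (hM' i0)
  refine ⟨min 1 (ε / (M + 1)), lt_min one_pos (by positivity), ?_⟩
  intro y hy hxy
  set δ := min 1 (ε / (M + 1)) with hδ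
  have hδ0 : 0 ≤ δ := (lt_min one_pos (by positivity)).le
  obtain ⟨C, hC⟩ := hy.2
  have hd : ∀ j, |x j - y j| ≤ δ := by
    intro j
    refine le_trans (le_ciSup (f := fun i => |x i - y i|) ⟨B + C, ?_⟩ j) hxy
    rintro _ ⟨k, rfl⟩
    exact (abs_sub _ _).trans (add_le_add (hB ⟨k, rfl⟩) (hC ⟨k, rfl⟩))
  have hyB : ∀ j, y j ≤ B + 1 := by
    intro j
    have := (abs_le.1 (hd j)).1
    have h3 : δ ≤ 1 := min_le_left _ _
    linarith [hxB j]
  have hxB' : ∀ j, x j ≤ B + 1 := fun j => by linarith [hxB j]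
  haveI : Nonempty I := ⟨i0⟩
  refine ciSup_le fun i => ?_
  have hsx := hsum x hx.1 hxB' i
  have hsy := hsum y hy.1 hyB i
  have hb : ∀ j, |γ i j (x j) - γ i j (y j)| ≤ L i j * δ := fun j =>
    (habs i j _ _ (hx.1 j) (hy.1 j) (hxB' j) (hyB j)).trans
      (mul_le_mul_of_nonneg_left (hd j) (hL0 i j))
  have hLs : Summable fun j => L i j * δ := (h2 i).mul_right δ
  have hfin : |gainOpSum γ x i - gainOpSum γ y i| ≤ ∑' j, L i j * δ := by
    unfold gainOpSum
    rw [← hsx.tsum_sub hsy, ← Real.norm_eq_abs]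
    exact tsum_of_norm_bounded hLs.hasSum hb
  refine hfin.trans ?_
  rw [tsum_mul_right]
  calc (∑' j, L i j) * δ ≤ (M + 1) * (ε / (M + 1)) :=
        mul_le_mul (by linarith [hM' i]) (min_le_right _ _) hδ0 (by linarith)
    _ = ε := by field_simp
end
end

section
/- Let (X, X⁺) be an ordered Banach space and A : X⁺ → X⁺ a (possibly nonlinear) operator. If the discrete-time system x(k+1) ≤ A(x(k)) + u(k) has the monotone limit (MLIM) property, then the operator id − A has the monotone bounded invertibility (MBI) property. -/
open Filter Set

noncomputable section

/-- The monotone limit (MLIM) property of the discrete-time system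
`x(k+1) ≤ A(x(k)) + u(k)` induced by `A` on the cone `C`
(order: `x ≤ y` iff `y - x ∈ C`). -/
def MLIM {X : Type*} [NormedAddCommGroup X] (C : Set X) (A : X → X) : Prop :=
  ∃ ξ : ℝ → ℝ, IsClassKInf ξ ∧
    ∀ ε : ℝ, 0 < ε → ∀ w ∈ C, ∀ x : ℕ → X,
      (∀ k, x k ∈ C) → (∀ k, x k - x (k + 1) ∈ C) →
      (∀ k, A (x k) + w - x (k + 1) ∈ C) →
      ∃ N : ℕ, ‖x N‖ ≤ ε + ξ ‖w‖

/-- The monotone bounded invertibility (MBI) property of `id - A` on the cone `C`: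
`v - A(v) ≤ w` implies `‖v‖ ≤ ξ(‖w‖)`. -/
def MBI {X : Type*} [NormedAddCommGroup X] (C : Set X) (A : X → X) : Prop :=
  ∃ ξ : ℝ → ℝ, IsClassKInf ξ ∧
    ∀ v ∈ C, ∀ w ∈ C, w - (v - A v) ∈ C → ‖v‖ ≤ ξ ‖w‖

/-- In an ordered Banach space `(X, X⁺)` (cone `C`), if the discrete-time system
`x(k+1) ≤ A(x(k)) + u(k)` has the MLIM property, then `id − A` has the MBI property. -/
theorem mbi_of_mlim
    {X : Type*} [NormedAddCommGroup X] [NormedSpace ℝ X] [CompleteSpace X]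
    (C : Set X) (hclosed : IsClosed C)
    (hadd : ∀ x ∈ C, ∀ y ∈ C, x + y ∈ C)
    (hsmul : ∀ r : ℝ, 0 ≤ r → ∀ x ∈ C, r • x ∈ C)
    (hpointed : ∀ x ∈ C, -x ∈ C → x = 0)
    (A : X → X) (hA : ∀ x ∈ C, A x ∈ C)
    (hmlim : MLIM C A) : MBI C A := by
  obtain ⟨ξ, hξ, h⟩ := hmlim
  refine ⟨ξ, hξ, fun v hv w hw hvw => ?_⟩
  refine le_of_forall_pos_le_add fun ε hε => ?_
  obtain ⟨_, hN⟩ := h ε hε w hw (fun _ => v) (fun _ => hv)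
    (fun _ => by simpa using hsmul 0 le_rfl v hv)
    (fun _ => by
      have e : A v + w - v = w - (v - A v) := by abel
      simpa only [e] using hvw)
  linarith
end
end

section
/- Let (X, X⁺) be an ordered Banach space with a normal cone X⁺, and let A : X⁺ → X⁺ be a continuous monotone operator. Assume that the cone X⁺ has the Levi property or that A is compact (maps bounded sets onto precompact sets). Then the following are equivalent: (i) the discrete-time system x(k+1) ≤ A(x(k)) + u(k) has the monotone limit (MLIM) property; (ii) the operator id − A has the monotone bounded invertibility (MBI) property. -/
open Filter Set

noncomputable section

/-- Ordered Banach space with normal cone, `A : X⁺ → X⁺` continuous and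
monotone. If the cone has the Levi property or `A` is compact, then the MLIM property of
the system `x(k+1) ≤ A(x(k)) + u(k)` is equivalent to the MBI property of `id − A`. -/
theorem mlim_iff_mbi_of_levi_or_compact
    {X : Type*} [NormedAddCommGroup X] [NormedSpace ℝ X] [CompleteSpace X]
    (C : Set X) (hclosed : IsClosed C)
    (hadd : ∀ x ∈ C, ∀ y ∈ C, x + y ∈ C)
    (hsmul : ∀ r : ℝ, 0 ≤ r → ∀ x ∈ C, r • x ∈ C)
    (hpointed : ∀ x ∈ C, -x ∈ C → x = 0)
    (hnormal : ∃ δ : ℝ, 0 < δ ∧ ∀ x y : X, x ∈ C → y - x ∈ C → ‖x‖ ≤ δ * ‖y‖)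
    (A : X → X) (hA : ∀ x ∈ C, A x ∈ C)
    (hcont : ContinuousOn A C)
    (hmono : ∀ x ∈ C, ∀ y ∈ C, y - x ∈ C → A y - A x ∈ C)
    (hLevi_or_compact :
      (∀ x : ℕ → X, (∀ k, x k ∈ C) → (∀ k, x k - x (k + 1) ∈ C) →
        ∃ l : X, Filter.Tendsto x Filter.atTop (nhds l)) ∨
      (∀ s : Set X, s ⊆ C → Bornology.IsBounded s → IsCompact (closure (A '' s)))) :
    MLIM C A ↔ MBI C A := by
  obtain ⟨δ, hδ, hn⟩ := hnormal
  constructor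
  · rintro ⟨ξ, hξ, h⟩
    refine ⟨ξ, hξ, fun v hv w hw hvw => ?_⟩
    refine le_of_forall_pos_le_add fun ε hε => ?_
    obtain ⟨N, hN⟩ := h ε hε w hw (fun _ => v) (fun _ => hv)
      (fun _ => by
        have := hsmul 0 le_rfl v hv
        simpa using this)
      (fun _ => by
        have e : A v + w - v = w - (v - A v) := by abel
        rw [e]; exact hvw)
    linarith
  · rintro ⟨ξ, ⟨⟨hξc, hξm, hξ0⟩, hξt⟩, h⟩
    refine ⟨fun t => δ * ξ t, ⟨⟨hξc.const_smul δ, ?_, by simp [hξ0]⟩,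
      hξt.const_mul_atTop hδ⟩, ?_⟩
    · intro a ha b hb hab
      exact mul_lt_mul_of_pos_left (hξm ha hb hab) hδ
    intro ε hε w hw x hx hdec hsys
    have h0 : (0 : X) ∈ C := by simpa using hsmul 0 le_rfl _ hw
    have htrans : ∀ a b c : X, a - b ∈ C → b - c ∈ C → a - c ∈ C := by
      intro a b c h1 h2
      have := hadd _ h1 _ h2
      rwa [sub_add_sub_cancel] at this
    have hanti : ∀ m n, m ≤ n → x m - x n ∈ C := by
      intro m n hmn
      induction n, hmn using Nat.le_induction with
      | base => simpa using h0
      | succ n _ ih => exact htrans _ _ _ ih (hdec n)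
    have hsub : ∃ y : X, ∃ φ : ℕ → ℕ, StrictMono φ ∧
        Tendsto (fun n => A (x (φ n))) atTop (nhds y) := by
      rcases hLevi_or_compact with hL | hK
      · obtain ⟨y, hy⟩ := hL (fun k => A (x k)) (fun k => hA _ (hx k))
          (fun k => hmono _ (hx _) _ (hx _) (hdec k))
        exact ⟨y, id, strictMono_id, hy⟩
      · have hb : Bornology.IsBounded (Set.range x) := by
          refine isBounded_iff_forall_norm_le.2 ⟨δ * ‖x 0‖, ?_⟩
          rintro _ ⟨k, rfl⟩
          exact hn _ _ (hx k) (hanti 0 k (Nat.zero_le k))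
        have hc := hK (Set.range x) (by rintro _ ⟨k, rfl⟩; exact hx k) hb
        obtain ⟨y, -, φ, hφ, hy⟩ := hc.tendsto_subseq (x := fun k => A (x k))
          (fun k => subset_closure ⟨x k, ⟨k, rfl⟩, rfl⟩)
        exact ⟨y, φ, hφ, hy⟩
    obtain ⟨y, φ, hφ, hy⟩ := hsub
    have hyC : y ∈ C := hclosed.mem_of_tendsto hy (Eventually.of_forall fun n => hA _ (hx _))
    have hvC : y + w ∈ C := hadd _ hyC _ hw
    have hyw : Tendsto (fun n => A (x (φ n)) + w) atTop (nhds (y + w)) := hy.add_const w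
    have hAw : Tendsto (fun n => A (A (x (φ n)) + w)) atTop (nhds (A (y + w))) := by
      refine (hcont _ hvC).tendsto.comp (tendsto_nhdsWithin_iff.2 ⟨hyw, ?_⟩)
      exact Eventually.of_forall fun n => hadd _ (hA _ (hx _)) _ hw
    have hlim := hAw.sub (hy.comp (tendsto_add_atTop_nat 1))
    have hle : A (y + w) - y ∈ C := by
      refine hclosed.mem_of_tendsto hlim (Eventually.of_forall fun n => ?_)
      refine hmono _ (hx _) _ (hadd _ (hA _ (hx _)) _ hw) ?_
      exact htrans _ _ _ (hsys (φ n)) (hanti _ _ (hφ (Nat.lt_succ_self n)))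
    have hv := h (y + w) hvC w hw (by
      have e : w - (y + w - A (y + w)) = A (y + w) - y := by abel
      rw [e]; exact hle)
    have hnorm : Tendsto (fun n => δ * ‖A (x (φ n)) + w‖) atTop (nhds (δ * ‖y + w‖)) :=
      hyw.norm.const_mul δ
    have hlt : δ * ‖y + w‖ < ε + δ * ξ ‖w‖ := by
      have := mul_le_mul_of_nonneg_left hv hδ.le
      linarith
    obtain ⟨n, hnn⟩ := (hnorm.eventually_lt_const hlt).exists
    exact ⟨φ n + 1, (hn _ _ (hx _) (hsys (φ n))).trans hnn.le⟩
end
end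

section
/- Let (X, X⁺) be an ordered Banach space whose cone X⁺ is generating, so that there exists a constant M > 0 such that every x ∈ X can be written x = y − z with y, z ∈ X⁺ and ‖y‖, ‖z‖ ≤ M‖x‖. Then for every (possibly nonlinear) operator A : X⁺ → X⁺ the following are equivalent: (i) the operator id − A has the monotone bounded invertibility (MBI) property; (ii) A satisfies the uniform small-gain condition, i.e., there exists η of class K∞ such that dist(A(x) − x, X⁺) ≥ η(‖x‖) for all x ∈ X⁺. -/
open Filter Set

noncomputable section

theorem kinf_inverse (γ : ℝ → ℝ) (h : IsClassKInf γ) :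
    ∃ δ : ℝ → ℝ, IsClassKInf δ ∧ (∀ s, 0 ≤ s → δ (γ s) = s) ∧ (∀ s, 0 ≤ s → 0 ≤ γ s) := by
  obtain ⟨⟨hc, hm, h0⟩, ht⟩ := h
  have hnn : ∀ s, 0 ≤ s → 0 ≤ γ s := by
    intro s hs
    have := hm.monotoneOn (Set.mem_Ici.2 le_rfl) (Set.mem_Ici.2 hs) hs
    rwa [h0] at this
  let g : ℝ → ℝ := fun x => if 0 ≤ x then γ x else x
  have gpos : ∀ x, 0 ≤ x → g x = γ x := fun x hx => if_pos hx
  have gneg : ∀ x, ¬ 0 ≤ x → g x = x := fun x hx => if_neg hx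
  have gm : StrictMono g := by
    intro a b hab
    by_cases ha : 0 ≤ a
    · have hb : 0 ≤ b := ha.trans hab.le
      rw [gpos a ha, gpos b hb]
      exact hm ha hb hab
    · rw [gneg a ha]
      by_cases hb : 0 ≤ b
      · rw [gpos b hb]
        exact (not_le.1 ha).trans_le (hnn b hb)
      · rwa [gneg b hb]
  have gs : Function.Surjective g := by
    intro y
    by_cases hy : 0 ≤ y
    · obtain ⟨N, hN0, hN⟩ := ((eventually_ge_atTop (0:ℝ)).and (ht.eventually_ge_atTop y)).exists
      have := intermediate_value_Icc hN0 (hc.mono Set.Icc_subset_Ici_self)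
      obtain ⟨x, hx, hxy⟩ := this ⟨by rw [h0]; exact hy, hN⟩
      exact ⟨x, by rw [gpos x hx.1, hxy]⟩
    · exact ⟨y, gneg y hy⟩
  let e := gm.orderIsoOfSurjective g gs
  have he : ∀ s, 0 ≤ s → e.symm (γ s) = s := by
    intro s hs
    rw [← gpos s hs]
    exact e.symm_apply_apply s
  refine ⟨e.symm, ⟨⟨e.symm.continuous.continuousOn, e.symm.strictMono.strictMonoOn _, ?_⟩,
    e.symm.tendsto_atTop⟩, he, hnn⟩
  have := he 0 le_rfl
  rwa [h0] at this

/-- Ordered Banach space with a generating cone (with bounded decomposition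
constant `M`). For every operator `A : X⁺ → X⁺`: `id − A` has the MBI property iff `A`
satisfies the uniform small-gain condition `dist(A(x) − x, X⁺) ≥ η(‖x‖)` for all `x ∈ X⁺`. -/
theorem mbi_iff_uniform_small_gain
    {X : Type*} [NormedAddCommGroup X] [NormedSpace ℝ X] [CompleteSpace X]
    (C : Set X) (hclosed : IsClosed C)
    (hadd : ∀ x ∈ C, ∀ y ∈ C, x + y ∈ C)
    (hsmul : ∀ r : ℝ, 0 ≤ r → ∀ x ∈ C, r • x ∈ C)
    (hpointed : ∀ x ∈ C, -x ∈ C → x = 0)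
    (hgen : ∃ M : ℝ, 0 < M ∧ ∀ x : X, ∃ y ∈ C, ∃ z ∈ C,
      x = y - z ∧ ‖y‖ ≤ M * ‖x‖ ∧ ‖z‖ ≤ M * ‖x‖)
    (A : X → X) (hA : ∀ x ∈ C, A x ∈ C) :
    MBI C A ↔
      ∃ η : ℝ → ℝ, IsClassKInf η ∧ ∀ x ∈ C, η ‖x‖ ≤ Metric.infDist (A x - x) C := by
  constructor
  · rintro ⟨ξ, hξ, H⟩
    obtain ⟨M, hM, hdec⟩ := hgen
    obtain ⟨δ, ⟨⟨dc, dm, d0⟩, dt⟩, hδ, hnn⟩ := kinf_inverse ξ hξ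
    refine ⟨fun t => δ t / M, ⟨⟨dc.div_const M, ?_, by simp [d0]⟩, dt.atTop_div_const hM⟩, ?_⟩
    · intro a ha b hb hab
      exact div_lt_div_of_pos_right (dm ha hb hab) hM
    · intro v hv
      refine (Metric.le_infDist ⟨v, hv⟩).2 ?_
      intro z hz
      obtain ⟨y, hy, y', hy', hx, hny, -⟩ := hdec (z - (A v - v))
      have h1 : y - (v - A v) ∈ C := by
        have : y - (v - A v) = z + y' := by
          have : y = z - (A v - v) + y' := by rw [hx]; abel
          rw [this]; abel
        rw [this]; exact hadd _ hz _ hy'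
      have h2 := H v hv y hy h1
      have h3 : δ ‖v‖ ≤ ‖y‖ := by
        rw [← hδ ‖y‖ (norm_nonneg _)]
        exact dm.monotoneOn (norm_nonneg _) (hnn _ (norm_nonneg _)) h2
      rw [dist_comm, dist_eq_norm]
      exact (div_le_iff₀' hM).2 (h3.trans hny)
  · rintro ⟨η, hη, H⟩
    obtain ⟨δ, hδK, hδ, hnn⟩ := kinf_inverse η hη
    refine ⟨δ, hδK, ?_⟩
    intro v hv w hw hwv
    have h1 : η ‖v‖ ≤ ‖w‖ := by
      refine (H v hv).trans ((Metric.infDist_le_dist_of_mem hwv).trans ?_)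
      rw [dist_comm, dist_eq_norm]
      apply le_of_eq
      congr 1
      abel
    rw [← hδ ‖v‖ (norm_nonneg _)]
    exact hδK.1.2.1.monotoneOn (hnn _ (norm_nonneg _)) (norm_nonneg _) h1
end
end

section
/- Let (X, X⁺) be an ordered Banach space whose cone X⁺ has nonempty interior, and let z be an interior point of X⁺. Then for every (possibly nonlinear) operator A : X⁺ → X⁺ the following are equivalent: (i) there exists η of class K∞ such that A(x) ≱ x − η(‖x‖)z for all x ∈ X⁺ \ {0}; (ii) A satisfies the uniform small-gain condition, i.e., there exists η of class K∞ such that dist(A(x) − x, X⁺) ≥ η(‖x‖) for all x ∈ X⁺. -/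
open Filter Set

noncomputable section

/-- Ordered Banach space whose cone `C` has nonempty interior, `z` an interior
point of `C`. For every operator `A : X⁺ → X⁺`, the following are equivalent:
(i) there is `η ∈ K∞` with `A(x) ≱ x − η(‖x‖)z` for all `x ∈ C \ {0}`;
(ii) the uniform small-gain condition: there is `η ∈ K∞` with
`dist(A(x) − x, C) ≥ η(‖x‖)` for all `x ∈ C`. -/
theorem interior_point_small_gain_iff_uniform_small_gain
    {X : Type*} [NormedAddCommGroup X] [NormedSpace ℝ X] [CompleteSpace X]
    (C : Set X) (hclosed : IsClosed C)
    (hadd : ∀ x ∈ C, ∀ y ∈ C, x + y ∈ C)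
    (hsmul : ∀ r : ℝ, 0 ≤ r → ∀ x ∈ C, r • x ∈ C)
    (hpointed : ∀ x ∈ C, -x ∈ C → x = 0)
    (z : X) (hz : z ∈ interior C)
    (A : X → X) (hA : ∀ x ∈ C, A x ∈ C) :
    (∃ η : ℝ → ℝ, IsClassKInf η ∧
        ∀ x ∈ C, x ≠ 0 → A x - (x - η ‖x‖ • z) ∉ C) ↔
    (∃ η : ℝ → ℝ, IsClassKInf η ∧
        ∀ x ∈ C, η ‖x‖ ≤ Metric.infDist (A x - x) C) := by
  have hscale : ∀ (c : ℝ) (η : ℝ → ℝ), 0 < c → IsClassKInf η → IsClassKInf (fun t => c * η t) := by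
    rintro c η hc ⟨⟨h1, h2, h3⟩, h4⟩
    refine ⟨⟨continuousOn_const.mul h1, ?_, by simp [h3]⟩, h4.const_mul_atTop hc⟩
    intro a ha b hb hab
    exact mul_lt_mul_of_pos_left (h2 ha hb hab) hc
  have hpos : ∀ η : ℝ → ℝ, IsClassKInf η → ∀ x : X, x ≠ 0 → 0 < η ‖x‖ := by
    rintro η ⟨⟨h1, h2, h3⟩, h4⟩ x hx
    have h := h2 (Set.mem_Ici.2 le_rfl) (Set.mem_Ici.2 (norm_nonneg x)) (norm_pos_iff.2 hx)
    rwa [h3] at h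
  have hne : C.Nonempty := ⟨z, interior_subset hz⟩
  constructor
  · rintro ⟨η, hη, h⟩
    obtain ⟨δ, hδ, hball⟩ := Metric.mem_nhds_iff.1 (mem_interior_iff_mem_nhds.1 hz)
    refine ⟨fun t => δ * η t, hscale δ η hδ hη, ?_⟩
    intro x hx
    by_cases hx0 : x = 0
    · subst hx0
      simp only [norm_zero, hη.1.2.2, mul_zero]
      exact Metric.infDist_nonneg
    · have ht := hpos η hη x hx0
      by_contra hlt
      push Not at hlt
      obtain ⟨c, hc, hd⟩ := (Metric.infDist_lt_iff hne).1 hlt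
      apply h x hx hx0
      rw [dist_eq_norm] at hd
      set t := η ‖x‖
      have hmem : z + t⁻¹ • (A x - x - c) ∈ C := by
        apply hball
        rw [Metric.mem_ball, dist_eq_norm, add_sub_cancel_left, norm_smul, norm_inv,
          Real.norm_of_nonneg ht.le, inv_mul_lt_iff₀ ht]
        linarith
      have h2 := hadd _ (hsmul t ht.le _ hmem) _ hc
      rw [smul_add, smul_inv_smul₀ ht.ne'] at h2
      convert h2 using 1
      abel
  · rintro ⟨η, hη, h⟩
    have hn : 0 < ‖z‖ + 1 := by positivity
    refine ⟨fun t => (‖z‖ + 1)⁻¹ * η t, hscale _ η (inv_pos.2 hn) hη, ?_⟩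
    intro x hx hx0 hmem
    have ht := hpos η hη x hx0
    have h1 := (h x hx).trans (Metric.infDist_le_dist_of_mem hmem)
    rw [dist_eq_norm] at h1
    have e : A x - x - (A x - (x - ((‖z‖ + 1)⁻¹ * η ‖x‖) • z))
        = -(((‖z‖ + 1)⁻¹ * η ‖x‖) • z) := by abel
    rw [e, norm_neg, norm_smul, Real.norm_of_nonneg (by positivity), mul_assoc,
      le_inv_mul_iff₀ hn] at h1
    nlinarith
end
end

section
/- Let I be a nonempty index set. A (possibly nonlinear) operator A : ℓ∞(I)⁺ → ℓ∞(I)⁺ satisfies the robust strong small-gain condition if and only if there exist ω, η of class K∞ such that, with η⃗ : ℓ∞(I)⁺ → ℓ∞(I)⁺ defined by η⃗(x) = (η(x_i))_{i∈I}, for every k ∈ I one has A(x) ≱ x − η⃗(x) − ω(‖x‖_{ℓ∞(I)})e_k for all x ∈ ℓ∞(I)⁺ \ {0}. -/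
open Filter Set

noncomputable section

/-- The strong small-gain condition for `A` with the `K∞` function `ρ`:
`D_ρ(A(x)) ≱ x` for all nonzero `x ∈ ℓ∞(I)⁺`, where `D_ρ(y)_i = y_i + ρ(y_i)`. -/
def StrongSGCWith {I : Type*} (A : (I → ℝ) → I → ℝ) (ρ : ℝ → ℝ) : Prop :=
  ∀ x : I → ℝ, InLinfPos x → x ≠ 0 → ¬ ∀ i, x i ≤ A x i + ρ (A x i)

/-- The strong small-gain condition: `StrongSGCWith` holds for some `ρ ∈ K∞`. -/
def StrongSGC {I : Type*} (A : (I → ℝ) → I → ℝ) : Prop :=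
  ∃ ρ : ℝ → ℝ, IsClassKInf ρ ∧ StrongSGCWith A ρ

/-- The robust strong small-gain condition: there are `ω, ρ ∈ K∞` with `ω < id` such that
for all `i, j` the perturbed operator `A_{i,j}(x) = A(x) + ω(x_j)e_i` satisfies the strong
small-gain condition with the same `ρ`. -/
def RobustStrongSGC {I : Type*} [DecidableEq I] (A : (I → ℝ) → I → ℝ) : Prop :=
  ∃ ω ρ : ℝ → ℝ, IsClassKInf ω ∧ IsClassKInf ρ ∧ (∀ r : ℝ, 0 < r → ω r < r) ∧
    ∀ i j : I, StrongSGCWith (fun x l => A x l + if l = i then ω (x j) else 0) ρ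

theorem kinf_half : IsClassKInf (fun r => r / 2) := by
  refine ⟨⟨by fun_prop, ?_, by simp⟩, ?_⟩
  · intro a _ b _ hab
    show a / 2 < b / 2
    linarith
  · exact tendsto_id.atTop_div_const (by norm_num)

theorem kinf_comp_half {f : ℝ → ℝ} (hf : IsClassKInf f) :
    IsClassKInf (fun r => f (r / 2)) := by
  obtain ⟨⟨hc, hm, h0⟩, ht⟩ := hf
  have hmaps : ∀ a : ℝ, a ∈ Set.Ici (0:ℝ) → a / 2 ∈ Set.Ici (0:ℝ) := by
    intro a ha
    simp only [Set.mem_Ici] at *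
    linarith
  refine ⟨⟨hc.comp (by fun_prop) hmaps, ?_, by simpa using h0⟩, ht.comp kinf_half.2⟩
  intro a ha b hb hab
  exact hm (hmaps a ha) (hmaps b hb) (by linarith)

theorem kinf_min {f g : ℝ → ℝ} (hf : IsClassKInf f) (hg : IsClassKInf g) :
    IsClassKInf (fun r => min (f r) (g r)) := by
  obtain ⟨⟨hc, hm, h0⟩, ht⟩ := hf
  obtain ⟨⟨hc', hm', h0'⟩, ht'⟩ := hg
  refine ⟨⟨ContinuousOn.inf hc hc', ?_, by simp [h0, h0']⟩, ?_⟩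
  · intro a ha b hb hab
    exact min_lt_min (hm ha hb hab) (hm' ha hb hab)
  · rw [tendsto_atTop] at *
    intro b
    filter_upwards [ht b, ht' b] with a h1 h2
    exact le_min h1 h2

theorem kinf_nonneg {f : ℝ → ℝ} (hf : IsClassKInf f) {r : ℝ} (hr : 0 ≤ r) : 0 ≤ f r := by
  have := hf.1.2.1.monotoneOn (Set.mem_Ici.2 le_rfl) (Set.mem_Ici.2 hr) hr
  rwa [hf.1.2.2] at this

theorem kinf_mono {f : ℝ → ℝ} (hf : IsClassKInf f) {r s : ℝ} (hr : 0 ≤ r) (h : r ≤ s) :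
    f r ≤ f s :=
  hf.1.2.1.monotoneOn (Set.mem_Ici.2 hr) (Set.mem_Ici.2 (hr.trans h)) h

/-- An operator `A : ℓ∞(I)⁺ → ℓ∞(I)⁺` satisfies the robust strong small-gain
condition iff there are `ω, η ∈ K∞` such that for every `k ∈ I`,
`A(x) ≱ x − η⃗(x) − ω(‖x‖)e_k` for all nonzero `x ∈ ℓ∞(I)⁺`. -/
theorem robustStrongSGC_iff
    {I : Type*} [Nonempty I] [DecidableEq I] (A : (I → ℝ) → I → ℝ)
    (hA : ∀ x, InLinfPos x → InLinfPos (A x)) :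
    RobustStrongSGC A ↔
      ∃ ω η : ℝ → ℝ, IsClassKInf ω ∧ IsClassKInf η ∧
        ∀ k : I, ∀ x : I → ℝ, InLinfPos x → x ≠ 0 →
          ¬ ∀ i, x i - η (x i) - (if i = k then ω (supNorm x) else 0) ≤ A x i := by
  constructor
  · rintro ⟨ω, ρ, hω, hρ, -, H⟩
    refine ⟨fun r => ω (r / 2), fun r => min (r / 2) (ρ (r / 2)), kinf_comp_half hω,
      kinf_min kinf_half (kinf_comp_half hρ), ?_⟩
    intro k x hx hx0 hall
    obtain ⟨i0, hi0⟩ := Function.ne_iff.1 hx0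
    have hpos : 0 < supNorm x :=
      lt_of_lt_of_le (abs_pos.2 hi0) (le_ciSup hx.2 i0)
    obtain ⟨j, hj⟩ : ∃ j, supNorm x / 2 < |x j| :=
      exists_lt_of_lt_ciSup (show supNorm x / 2 < supNorm x by linarith)
    rw [abs_of_nonneg (hx.1 j)] at hj
    have hωj : ω (supNorm x / 2) ≤ ω (x j) := kinf_mono hω (by linarith) hj.le
    refine H k j x hx hx0 ?_
    intro l
    have hl := hall l
    have hxl := hx.1 l
    have hAl := (hA x hx).1 l
    have hωn := kinf_nonneg hω (hx.1 j)
    obtain ⟨y, hy⟩ : ∃ y, y = A x l + if l = k then ω (x j) else 0 := ⟨_, rfl⟩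
    have hy1 : x l - min (x l / 2) (ρ (x l / 2)) ≤ y := by
      rw [hy]
      split_ifs at hl ⊢ <;> linarith
    have h1 := min_le_left (x l / 2) (ρ (x l / 2))
    have h2 := min_le_right (x l / 2) (ρ (x l / 2))
    have h3 : ρ (x l / 2) ≤ ρ y := kinf_mono hρ (by linarith) (by linarith)
    show x l ≤ (A x l + if l = k then ω (x j) else 0) +
      ρ (A x l + if l = k then ω (x j) else 0)
    rw [← hy]
    linarith
  · rintro ⟨ω, η, hω, hη, H⟩
    refine ⟨fun r => min (ω r) (r / 2), η, kinf_min hω kinf_half, hη, ?_, ?_⟩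
    · intro r hr
      exact lt_of_le_of_lt (min_le_right _ _) (by linarith)
    intro k j x hx hx0 hall
    refine H k x hx hx0 ?_
    intro l
    have hxl := hx.1 l
    have hAl := (hA x hx).1 l
    have hjn : x j ≤ supNorm x := (le_abs_self _).trans (le_ciSup hx.2 j)
    have hωj : min (ω (x j)) (x j / 2) ≤ ω (supNorm x) :=
      (min_le_left _ _).trans (kinf_mono hω (hx.1 j) hjn)
    have hωn : 0 ≤ min (ω (x j)) (x j / 2) :=
      le_min (kinf_nonneg hω (hx.1 j)) (by linarith [hx.1 j])
    obtain ⟨y, hy⟩ : ∃ y, y = A x l + if l = k then min (ω (x j)) (x j / 2) else 0 := ⟨_, rfl⟩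
    have hl : x l ≤ y + η y := by
      rw [hy]
      exact hall l
    have hy0 : 0 ≤ y := by
      rw [hy]
      split_ifs <;> linarith
    have hy1 : x l - η (x l) ≤ y := by
      rcases le_total (x l) y with h | h
      · linarith [kinf_nonneg hη hxl]
      · linarith [kinf_mono hη hy0 h]
    split_ifs at hy ⊢ <;> linarith
end
end

section
/- Let I be a nonempty index set. A (possibly nonlinear) operator A : ℓ∞(I)⁺ → ℓ∞(I)⁺ satisfies the strong small-gain condition if and only if there exists η of class K∞ such that, with η⃗ : ℓ∞(I)⁺ → ℓ∞(I)⁺ defined by η⃗(x) = (η(x_i))_{i∈I}, one has A(x) ≱ x − η⃗(x) for all x ∈ ℓ∞(I)⁺ \ {0}. -/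
open Filter Set

noncomputable section

/-- An operator `A : ℓ∞(I)⁺ → ℓ∞(I)⁺` satisfies the strong small-gain
condition iff there is `η ∈ K∞` such that `A(x) ≱ x − η⃗(x)` for all nonzero
`x ∈ ℓ∞(I)⁺`, where `η⃗(x)_i = η(x_i)`. -/
theorem strongSGC_iff
    {I : Type*} [Nonempty I] (A : (I → ℝ) → I → ℝ)
    (hA : ∀ x, InLinfPos x → InLinfPos (A x)) :
    StrongSGC A ↔
      ∃ η : ℝ → ℝ, IsClassKInf η ∧
        ∀ x : I → ℝ, InLinfPos x → x ≠ 0 → ¬ ∀ i, x i - η (x i) ≤ A x i := by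
  constructor
  · rintro ⟨ρ, ⟨⟨hc, hm, h0⟩, ht⟩, h⟩
    have maps : Set.MapsTo (fun r : ℝ => r / 2) (Set.Ici 0) (Set.Ici 0) := by
      intro r hr
      simp only [Set.mem_Ici] at *
      linarith
    refine ⟨fun r => min (r / 2) (ρ (r / 2)), ⟨⟨?_, ?_, ?_⟩, ?_⟩, ?_⟩
    · have h1 : ContinuousOn (fun r : ℝ => r / 2) (Set.Ici 0) := by fun_prop
      exact ContinuousOn.inf h1 (hc.comp h1 maps)
    · intro a ha b hb hab
      have h1 : a / 2 < b / 2 := by linarith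
      exact min_lt_min h1 (hm (maps ha) (maps hb) h1)
    · simp [h0]
    · have h1 : Filter.Tendsto (fun r : ℝ => r / 2) Filter.atTop Filter.atTop :=
        Filter.tendsto_id.atTop_div_const (by norm_num)
      have h2 := ht.comp h1
      rw [Filter.tendsto_atTop] at *
      intro b
      filter_upwards [h1 b, h2 b] with r hr1 hr2
      exact le_min hr1 hr2
    · intro x hx hx0 hle
      refine h x hx hx0 fun i => ?_
      have h1 := hle i
      have hy := (hA x hx).1 i
      have hxi := hx.1 i
      by_contra! hlt
      have e1 := min_le_left (x i / 2) (ρ (x i / 2))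
      have e2 := min_le_right (x i / 2) (ρ (x i / 2))
      simp only at h1
      rcases lt_or_ge (A x i) (x i / 2) with h3 | h3
      · linarith
      · have := hm.monotoneOn (maps hxi) (Set.mem_Ici.2 hy) h3
        simp only at this
        linarith
  · rintro ⟨η, ⟨⟨hc, hm, h0⟩, ht⟩, h⟩
    refine ⟨η, ⟨⟨hc, hm, h0⟩, ht⟩, ?_⟩
    intro x hx hx0 hle
    refine h x hx hx0 fun i => ?_
    have h1 := hle i
    have hy := (hA x hx).1 i
    have hxi := hx.1 i
    by_contra! hlt
    have e := hm.monotoneOn (Set.mem_Ici.2 le_rfl) (Set.mem_Ici.2 hxi) hxi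
    have := hm.monotoneOn (Set.mem_Ici.2 hy) (Set.mem_Ici.2 hxi) (by linarith)
    linarith
end
end

section
/- Let I be a nonempty index set and A : ℓ∞(I)⁺ → ℓ∞(I)⁺ a (possibly nonlinear) operator. If A satisfies the uniform small-gain condition, then A satisfies the robust strong small-gain condition. -/
open Filter Set

noncomputable section

/-- If `A : ℓ∞(I)⁺ → ℓ∞(I)⁺` satisfies the uniform small-gain condition
(`dist(A(x) − x, ℓ∞(I)⁺) ≥ η(‖x‖)` for some `η ∈ K∞` and all `x ∈ ℓ∞(I)⁺`, expressed here
via lower bounds against all elements of the cone), then `A` satisfies the robust strong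
small-gain condition. -/
theorem robustStrongSGC_of_uniform_small_gain
    {I : Type*} [Nonempty I] [DecidableEq I] (A : (I → ℝ) → I → ℝ)
    (hA : ∀ x, InLinfPos x → InLinfPos (A x))
    (husgc : ∃ η : ℝ → ℝ, IsClassKInf η ∧
      ∀ x : I → ℝ, InLinfPos x → ∀ z : I → ℝ, InLinfPos z →
        η (supNorm x) ≤ supNorm (fun i => A x i - x i - z i)) :
    RobustStrongSGC A := by
  obtain ⟨η, ⟨⟨hc, hm, h0⟩, ht⟩, H⟩ := husgc
  set ω : ℝ → ℝ := fun r => min (η r) r / 3 with hω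
  have hωm : StrictMonoOn ω (Set.Ici 0) := by
    intro a ha b hb hab
    have h1 := hm ha hb hab
    have : min (η a) a < min (η b) b :=
      lt_min (lt_of_le_of_lt (min_le_left _ _) h1) (lt_of_le_of_lt (min_le_right _ _) hab)
    simp only [hω]
    linarith
  have hω0 : ω 0 = 0 := by simp [hω, h0]
  have hωK : IsClassKInf ω := by
    refine ⟨⟨?_, hωm, hω0⟩, ?_⟩
    · exact (hc.inf continuousOn_id).div_const 3
    · refine Filter.Tendsto.atTop_div_const (by norm_num) ?_
      rw [Filter.tendsto_atTop] at ht ⊢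
      intro b
      filter_upwards [ht b, Filter.eventually_ge_atTop b] with r h1 h2
      exact le_min h1 h2
  have hωpos : ∀ r, 0 ≤ r → 0 ≤ ω r := by
    intro r hr
    have := hωm.monotoneOn (Set.mem_Ici.2 le_rfl) (Set.mem_Ici.2 hr) hr
    rwa [hω0] at this
  refine ⟨ω, ω, hωK, hωK, ?_, ?_⟩
  · intro r hr
    have : min (η r) r ≤ r := min_le_right _ _
    simp only [hω]
    linarith
  intro i j x hx hx0 hall
  have hAx := hA x hx
  have hN : ∀ l, x l ≤ supNorm x := fun l => (le_abs_self _).trans (le_ciSup hx.2 l)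
  have hNpos : 0 < supNorm x := by
    obtain ⟨l, hl⟩ := Function.ne_iff.1 hx0
    exact lt_of_lt_of_le (lt_of_le_of_ne (hx.1 l) (Ne.symm hl)) (hN l)
  have hηpos : 0 < η (supNorm x) := by
    have := hm (Set.mem_Ici.2 le_rfl) (Set.mem_Ici.2 hNpos.le) hNpos
    rwa [h0] at this
  have hωη : ω (supNorm x) ≤ η (supNorm x) / 3 := by
    have : min (η (supNorm x)) (supNorm x) ≤ η (supNorm x) := min_le_left _ _
    simp only [hω]
    linarith
  have hωN : ∀ r, 0 ≤ r → r ≤ supNorm x → ω r ≤ ω (supNorm x) := fun r h1 h2 =>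
    hωm.monotoneOn (Set.mem_Ici.2 h1) (Set.mem_Ici.2 hNpos.le) h2
  have key : ∀ l, x l - A x l ≤ 2 * ω (supNorm x) := by
    intro l
    have hl := hall l
    simp only at hl
    have hp0 : 0 ≤ (if l = i then ω (x j) else 0) := by
      split_ifs
      · exact hωpos _ (hx.1 j)
      · exact le_rfl
    have hp1 : (if l = i then ω (x j) else 0) ≤ ω (supNorm x) := by
      split_ifs
      · exact hωN _ (hx.1 j) (hN j)
      · exact hωpos _ hNpos.le
    generalize (if l = i then ω (x j) else 0) = p at hl hp0 hp1
    have hNN := hωpos _ hNpos.le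
    rcases le_total (x l) (A x l + p) with h | h
    · linarith
    · have := hωN (A x l + p) (add_nonneg (hAx.1 l) hp0) (h.trans (hN l))
      linarith
  have hz : InLinfPos (fun l => max (A x l - x l) 0) := by
    refine ⟨fun l => le_max_right _ _, ?_⟩
    obtain ⟨M, hM⟩ := hAx.2
    refine ⟨M, ?_⟩
    rintro _ ⟨l, rfl⟩
    have h1 : |A x l| ≤ M := hM ⟨l, rfl⟩
    have h2 := hx.1 l
    have h3 := hAx.1 l
    rw [abs_of_nonneg h3] at h1
    simp only
    rw [abs_of_nonneg (le_max_right _ _)]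
    exact max_le (by linarith) (by linarith)
  have h1 := H x hx _ hz
  have h2 : supNorm (fun l => A x l - x l - max (A x l - x l) 0) ≤ 2 * ω (supNorm x) := by
    refine ciSup_le fun l => ?_
    beta_reduce
    have hNN := hωpos _ hNpos.le
    have := key l
    rcases le_total (A x l - x l) 0 with h | h
    · rw [max_eq_right h, sub_zero, abs_of_nonpos h]
      linarith
    · rw [max_eq_left h, sub_self, abs_zero]
      linarith
  linarith
end
end

section
/- Let α : [0,∞) → [0,∞) be continuous with α(0) = 0 and α(r) > 0 for r > 0 (positive definite), and let L > 0. Define ρ(r) := inf_{y ≥ 0} { α(y) + L|y − r| }. Then: (i) ρ is positive definite, satisfies ρ(s) ≤ α(s) for all s ≥ 0, and is globally Lipschitz continuous with Lipschitz constant L; (ii) if α is of class K, then ρ is of class K; (iii) if α is of class K∞, then ρ is of class K∞. -/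
open Filter Set

noncomputable section

/-- For positive definite `α` and `L > 0`, the function
`ρ(r) = inf_{y ≥ 0} {α(y) + L|y − r|}` is positive definite, satisfies `ρ ≤ α` on `[0,∞)`,
and is globally Lipschitz with constant `L`; if `α ∈ K` then `ρ ∈ K`; if `α ∈ K∞`
then `ρ ∈ K∞`. -/
theorem lipschitz_lower_estimate_of_positive_definite
    (α : ℝ → ℝ) (hcont : ContinuousOn α (Set.Ici 0)) (h0 : α 0 = 0)
    (hpos : ∀ r : ℝ, 0 < r → 0 < α r)
    (L : ℝ) (hL : 0 < L)
    (ρ : ℝ → ℝ)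
    (hρ : ∀ r : ℝ, ρ r = ⨅ y : Set.Ici (0:ℝ), (α y.1 + L * |y.1 - r|)) :
    (ρ 0 = 0 ∧ (∀ r : ℝ, 0 < r → 0 < ρ r) ∧
      (∀ s : ℝ, 0 ≤ s → ρ s ≤ α s) ∧
      ContinuousOn ρ (Set.Ici 0) ∧
      (∀ r : ℝ, 0 ≤ r → ∀ s : ℝ, 0 ≤ s → |ρ r - ρ s| ≤ L * |r - s|)) ∧
    (IsClassK α → IsClassK ρ) ∧
    (IsClassKInf α → IsClassKInf ρ) := by
  have hnn : ∀ y : ℝ, 0 ≤ y → 0 ≤ α y := by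
    intro y hy
    rcases hy.eq_or_lt with h | h
    · rw [← h, h0]
    · exact (hpos y h).le
  have hle : ∀ r y : ℝ, 0 ≤ y → ρ r ≤ α y + L * |y - r| := by
    intro r y hy
    rw [hρ r]
    refine ciInf_le (f := fun y : Set.Ici (0:ℝ) => α y.1 + L * |y.1 - r|) ⟨0, ?_⟩ ⟨y, hy⟩
    rintro _ ⟨z, rfl⟩
    have := hnn z.1 z.2
    positivity
  have hmin : ∀ r : ℝ, 0 ≤ r → ∃ y : ℝ, 0 ≤ y ∧ ρ r = α y + L * |y - r| := by
    intro r hr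
    have hc : ContinuousOn (fun y => α y + L * |y - r|) (Set.Icc 0 (2 * r)) := by
      refine (hcont.mono Set.Icc_subset_Ici_self).add ?_
      fun_prop
    obtain ⟨y, hy, hym⟩ := isCompact_Icc.exists_isMinOn
      (Set.nonempty_Icc.2 (by linarith : (0:ℝ) ≤ 2 * r)) hc
    rw [isMinOn_iff] at hym
    refine ⟨y, hy.1, le_antisymm (hle r y hy.1) ?_⟩
    rw [hρ r]
    haveI : Nonempty (Set.Ici (0:ℝ)) := ⟨⟨0, le_refl (0:ℝ)⟩⟩
    refine le_ciInf ?_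
    rintro ⟨z, hz⟩
    have hz' : 0 ≤ z := hz
    rcases le_total z (2 * r) with h | h
    · exact hym z ⟨hz', h⟩
    · have h1 := hym 0 ⟨le_refl _, by linarith⟩
      have h2 : |(0:ℝ) - r| = r := by rw [zero_sub, abs_neg, abs_of_nonneg hr]
      simp only [h2, h0] at h1
      have h3 : r ≤ |z - r| := le_trans (by linarith) (le_abs_self _)
      have h4 := mul_le_mul_of_nonneg_left h3 hL.le
      have h5 := hnn z hz'
      simp only
      linarith
  have hlea : ∀ s : ℝ, 0 ≤ s → ρ s ≤ α s := by
    intro s hs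
    simpa using hle s s hs
  have hr0 : ρ 0 = 0 := by
    apply le_antisymm
    · simpa [h0] using hlea 0 le_rfl
    · obtain ⟨y, hy, e⟩ := hmin 0 le_rfl
      rw [e]
      have := hnn y hy
      positivity
  have hlip1 : ∀ r : ℝ, 0 ≤ r → ∀ s : ℝ, 0 ≤ s → ρ r - ρ s ≤ L * |r - s| := by
    intro r hr s hs
    obtain ⟨y, hy, e⟩ := hmin s hs
    have h1 := hle r y hy
    have h2 : |y - r| ≤ |y - s| + |r - s| := by
      rw [abs_sub_comm r s]; exact abs_sub_le y s r
    have h3 := mul_le_mul_of_nonneg_left h2 hL.le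
    linarith
  have hlip : ∀ r : ℝ, 0 ≤ r → ∀ s : ℝ, 0 ≤ s → |ρ r - ρ s| ≤ L * |r - s| := by
    intro r hr s hs
    rw [abs_le]
    have h1 := hlip1 r hr s hs
    have h2 := hlip1 s hs r hr
    rw [abs_sub_comm s r] at h2
    constructor <;> linarith
  have hcρ : ContinuousOn ρ (Set.Ici 0) := by
    have : LipschitzOnWith (Real.toNNReal L) ρ (Set.Ici 0) := by
      refine LipschitzOnWith.of_dist_le_mul ?_
      intro x hx y hy
      rw [Real.dist_eq, Real.dist_eq, Real.coe_toNNReal L hL.le]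
      exact hlip x hx y hy
    exact this.continuousOn
  have hK : IsClassK α → IsClassK ρ := by
    rintro ⟨-, hm, -⟩
    refine ⟨hcρ, ?_, hr0⟩
    intro r hr s hs hrs
    have hr' : 0 ≤ r := hr
    obtain ⟨y, hy, e⟩ := hmin s hs
    rcases le_or_gt y r with h | h
    · have h1 := hle r y hy
      have h2 : |y - r| < |y - s| := by
        rw [abs_of_nonpos (by linarith), abs_of_nonpos (by linarith)]; linarith
      have h3 := mul_lt_mul_of_pos_left h2 hL
      linarith
    · have h1 := hlea r hr'
      have h2 := hm hr hy h
      have h3 : 0 ≤ L * |y - s| := by positivity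
      linarith
  refine ⟨⟨hr0, ?_, hlea, hcρ, hlip⟩, hK, ?_⟩
  · intro r hr
    obtain ⟨y, hy, e⟩ := hmin r hr.le
    rw [e]
    rcases hy.eq_or_lt with h | h
    · rw [← h, h0, zero_sub, abs_neg, abs_of_pos hr]
      have := mul_pos hL hr
      linarith
    · have := hpos y h
      positivity
  · rintro ⟨hk, ht⟩
    refine ⟨hK hk, ?_⟩
    rw [tendsto_atTop]
    intro M
    obtain ⟨N, hN⟩ := eventually_atTop.1 (tendsto_atTop.1 ht M)
    filter_upwards [eventually_ge_atTop 0, eventually_ge_atTop (N + M / L)] with r hr hr2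
    obtain ⟨y, hy, e⟩ := hmin r hr
    rw [e]
    rcases le_total N y with h | h
    · have h1 := hN y h
      have h3 : 0 ≤ L * |y - r| := by positivity
      linarith
    · have h1 : M / L ≤ |y - r| := by
        rw [abs_sub_comm]
        exact le_trans (by linarith) (le_abs_self _)
      rw [div_le_iff₀ hL] at h1
      have := hnn y hy
      linarith
end
end

section
/- Let (X, X⁺) be an ordered Banach space whose cone X⁺ is generating and normal, and let A : X⁺ → X⁺ be the restriction to X⁺ of a positive bounded linear operator T on X (i.e., T(X⁺) ⊆ X⁺ and A = T|_{X⁺}). Then the following are equivalent: (i) the discrete-time system x(k+1) ≤ A(x(k)) + u(k) is exponentially input-to-state stable (eISS); (ii) the system x(k+1) ≤ A(x(k)) + u(k) has the monotone limit (MLIM) property; (iii) the operator id − A has the monotone bounded invertibility (MBI) property; (iv) the spectral radius of T satisfies r(T) < 1. -/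
open Filter Set

noncomputable section

/-- Exponential input-to-state stability (eISS) of the discrete-time system
`x(k+1) ≤ A(x(k)) + u(k)` on the cone `C`: there are `M ≥ 1`, `a ∈ (0,1)` and `γ ∈ K∞`
such that every solution satisfies `‖x(k)‖ ≤ M‖x(0)‖aᵏ + γ(‖u‖∞)`. -/
def EISS {X : Type*} [NormedAddCommGroup X] (C : Set X) (A : X → X) : Prop :=
  ∃ M : ℝ, 1 ≤ M ∧ ∃ a : ℝ, 0 < a ∧ a < 1 ∧ ∃ γ : ℝ → ℝ, IsClassKInf γ ∧
    ∀ u : ℕ → X, (∀ k, u k ∈ C) → BddAbove (Set.range fun k => ‖u k‖) →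
      ∀ x : ℕ → X, (∀ k, x k ∈ C) →
        (∀ k, A (x k) + u k - x (k + 1) ∈ C) →
        ∀ k, ‖x k‖ ≤ M * ‖x 0‖ * a ^ k + γ (⨆ j, ‖u j‖)

theorem aux_gelfand {X : Type*} [NormedAddCommGroup X] [NormedSpace ℝ X]
    (T : X →L[ℝ] X) (N : ℕ) (hN : 0 < N) (h : ‖T ^ N‖ < 1) :
    ∃ ρ : ℝ, ρ < 1 ∧
          Filter.Tendsto (fun m : ℕ => ‖T ^ m‖ ^ (1 / (m : ℝ)))
            Filter.atTop (nhds ρ) := by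
  let μ : RingSeminorm (Polynomial ℝ) :=
    { toFun := fun p => ‖Polynomial.aeval T p‖
      map_zero' := by simp
      add_le' := fun p q => by
        simp only [map_add]; exact norm_add_le _ _
      neg' := fun p => by simp
      mul_le' := fun p q => by
        simp only [map_mul]; exact norm_mul_le _ _ }
  have hμ : ∀ m : ℕ, μ (Polynomial.X ^ m) = ‖T ^ m‖ := fun m => by
    change ‖Polynomial.aeval T (Polynomial.X ^ m)‖ = _
    simp
  have h1 : μ 1 ≤ 1 := by
    have := hμ 0
    simp only [pow_zero] at this
    rw [this]
    exact ContinuousLinearMap.norm_id_le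
  refine ⟨smoothingFun μ Polynomial.X, ?_, ?_⟩
  · refine (smoothingFun_le μ Polynomial.X ⟨N, hN⟩).trans_lt ?_
    simp only [PNat.mk_coe, hμ]
    exact Real.rpow_lt_one (norm_nonneg _) h (by positivity)
  · have := tendsto_smoothingFun_of_map_one_le_one μ h1 Polynomial.X
    refine this.congr fun m => ?_
    rw [← hμ m]

theorem aux_bound {X : Type*} [NormedAddCommGroup X] [NormedSpace ℝ X]
    (T : X →L[ℝ] X) (ρ : ℝ) (hρ : ρ < 1)
    (h : Filter.Tendsto (fun m : ℕ => ‖T ^ m‖ ^ (1 / (m : ℝ)))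
            Filter.atTop (nhds ρ)) :
    ∃ a K : ℝ, 0 < a ∧ a < 1 ∧ 0 < K ∧ ∀ m : ℕ, ‖T ^ m‖ ≤ K * a ^ m := by
  obtain ⟨a, ha, ha1⟩ := exists_between (max_lt hρ zero_lt_one)
  have ha0 : 0 < a := (le_max_right _ _).trans_lt ha
  have haρ : ρ < a := (le_max_left _ _).trans_lt ha
  have hO : (fun m : ℕ => T ^ m) =O[atTop] (fun m : ℕ => a ^ m) := by
    refine Asymptotics.IsBigO.of_bound 1 ?_
    filter_upwards [h.eventually_lt_const haρ, eventually_gt_atTop 0] with m hm hm0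
    rw [one_mul, Real.norm_of_nonneg (by positivity)]
    have h2 : (‖T ^ m‖ ^ (1 / (m : ℝ))) ^ m ≤ a ^ m :=
      pow_le_pow_left₀ (by positivity) hm.le m
    rwa [one_div, Real.rpow_inv_natCast_pow (norm_nonneg _) hm0.ne'] at h2
  obtain ⟨K, hK, hb⟩ := Asymptotics.bound_of_isBigO_nat_atTop hO
  refine ⟨a, K, ha0, ha1, hK, fun m => ?_⟩
  have := hb (x := m) (by positivity)
  rwa [Real.norm_of_nonneg (by positivity)] at this

theorem aux_linear (c : ℝ) (hc : 0 < c) : IsClassKInf (fun s => c * s) := by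
  refine ⟨⟨by fun_prop, fun x _ y _ hxy => ?_, by simp⟩, ?_⟩
  · exact mul_lt_mul_of_pos_left hxy hc
  · exact tendsto_id.const_mul_atTop hc

theorem aux_iv_i {X : Type*} [NormedAddCommGroup X] [NormedSpace ℝ X]
    (C : Set X)
    (hadd : ∀ x ∈ C, ∀ y ∈ C, x + y ∈ C)
    (hsmul : ∀ r : ℝ, 0 ≤ r → ∀ x ∈ C, r • x ∈ C)
    (hnormal : ∃ δ : ℝ, 0 < δ ∧ ∀ x y : X, x ∈ C → y - x ∈ C → ‖x‖ ≤ δ * ‖y‖)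
    (T : X →L[ℝ] X) (hT : ∀ x ∈ C, T x ∈ C) (ρ : ℝ) (hρ : ρ < 1)
    (h : Filter.Tendsto (fun m : ℕ => ‖T ^ m‖ ^ (1 / (m : ℝ)))
            Filter.atTop (nhds ρ)) : EISS C (fun x => T x) := by
  obtain ⟨a, K, ha0, ha1, hK, hb⟩ := aux_bound T ρ hρ h
  obtain ⟨δ, hδ, hn⟩ := hnormal
  have ha1' : 0 < 1 - a := by linarith
  refine ⟨max 1 (δ * K), le_max_left _ _, a, ha0, ha1, fun s => (δ * K / (1 - a)) * s,
    aux_linear _ (by positivity), ?_⟩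
  intro u hu hub x hx hxu k
  set U := ⨆ j, ‖u j‖ with hU
  have huU : ∀ j, ‖u j‖ ≤ U := fun j => le_ciSup hub j
  have hU0 : 0 ≤ U := (norm_nonneg _).trans (huU 0)
  have key : ∀ k, ((T ^ k) (x 0) + ∑ j ∈ Finset.range k, (T ^ (k - 1 - j)) (u j)) - x k ∈ C := by
    intro k
    induction k with
    | zero =>
      have := hsmul 0 le_rfl _ (hx 0)
      simpa using this
    | succ k ih =>
      have h1 := hadd _ (hT _ ih) _ (hxu k)
      have h2 : ∑ j ∈ Finset.range k, T ((T ^ (k - 1 - j)) (u j))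
          = ∑ j ∈ Finset.range k, (T ^ (k - j)) (u j) := by
        refine Finset.sum_congr rfl fun j hj => ?_
        have hj' := Finset.mem_range.mp hj
        have : k - j = (k - 1 - j) + 1 := by omega
        rw [this, pow_succ']; rfl
      have h3 : T ((T ^ k) (x 0)) = (T ^ (k + 1)) (x 0) := by rw [pow_succ']; rfl
      rw [map_sub, map_add, map_sum, h2, h3] at h1
      rw [Finset.sum_range_succ]
      simp only [Nat.add_sub_cancel, Nat.sub_self, pow_zero, ContinuousLinearMap.one_apply]
      convert h1 using 1
      abel
  have h1 := hn _ _ (hx k) (key k)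
  have hTn : ∀ m y, ‖(T ^ m) y‖ ≤ K * a ^ m * ‖y‖ := fun m y =>
    ((T ^ m).le_opNorm y).trans (mul_le_mul_of_nonneg_right (hb m) (norm_nonneg _))
  have hgeo : ∑ j ∈ Finset.range k, a ^ j ≤ 1 / (1 - a) := by
    rw [le_div_iff₀ ha1', geom_sum_mul_neg]
    have : 0 < a ^ k := by positivity
    linarith
  have h2 : ‖∑ j ∈ Finset.range k, (T ^ (k - 1 - j)) (u j)‖ ≤ K * U * (1 / (1 - a)) := by
    calc _ ≤ ∑ j ∈ Finset.range k, K * U * a ^ (k - 1 - j) := by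
          refine norm_sum_le_of_le _ fun j _ => (hTn _ _).trans ?_
          have := mul_le_mul_of_nonneg_left (huU j) (show 0 ≤ K * a ^ (k - 1 - j) by positivity)
          linarith
      _ = K * U * ∑ j ∈ Finset.range k, a ^ j := by
          rw [← Finset.mul_sum, Finset.sum_range_reflect (fun j => a ^ j) k]
      _ ≤ _ := mul_le_mul_of_nonneg_left hgeo (by positivity)
  calc ‖x k‖ ≤ δ * (K * a ^ k * ‖x 0‖ + K * U * (1 / (1 - a))) := by
        refine h1.trans (mul_le_mul_of_nonneg_left ?_ hδ.le)
        exact (norm_add_le _ _).trans (add_le_add (hTn _ _) h2)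
    _ = (δ * K) * (‖x 0‖ * a ^ k) + (δ * K / (1 - a)) * U := by ring
    _ ≤ max 1 (δ * K) * (‖x 0‖ * a ^ k) + (δ * K / (1 - a)) * U := by
        gcongr
        exact le_max_right _ _
    _ = _ := by ring

theorem aux_i_ii {X : Type*} [NormedAddCommGroup X] (C : Set X) (A : X → X)
    (h : EISS C A) : MLIM C A := by
  obtain ⟨M, hM, a, ha0, ha1, γ, hγ, h⟩ := h
  refine ⟨γ, hγ, fun ε hε w hw x hx _ hxw => ?_⟩
  have h1 := h (fun _ => w) (fun _ => hw) ⟨‖w‖, by rintro _ ⟨k, rfl⟩; exact le_rfl⟩ x hx hxw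
  have h2 : Tendsto (fun k : ℕ => M * ‖x 0‖ * a ^ k) atTop (nhds 0) := by
    simpa using (tendsto_pow_atTop_nhds_zero_of_lt_one ha0.le ha1).const_mul (M * ‖x 0‖)
  obtain ⟨N, hN⟩ := (h2.eventually_lt_const hε).exists
  refine ⟨N, ?_⟩
  have h3 := h1 N
  rw [ciSup_const] at h3
  linarith

theorem aux_ii_iii {X : Type*} [NormedAddCommGroup X] (C : Set X) (A : X → X)
    (h0 : (0 : X) ∈ C) (h : MLIM C A) : MBI C A := by
  obtain ⟨ξ, hξ, h⟩ := h
  refine ⟨ξ, hξ, fun v hv w hw hvw => le_of_forall_pos_le_add fun ε hε => ?_⟩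
  obtain ⟨N, hN⟩ := h ε hε w hw (fun _ => v) (fun _ => hv) (fun _ => by simpa using h0)
    (fun _ => by convert hvw using 1; abel)
  linarith

theorem aux_iii_iv {X : Type*} [NormedAddCommGroup X] [NormedSpace ℝ X] [CompleteSpace X]
    (C : Set X)
    (hadd : ∀ x ∈ C, ∀ y ∈ C, x + y ∈ C)
    (hsmul : ∀ r : ℝ, 0 ≤ r → ∀ x ∈ C, r • x ∈ C)
    (h0 : (0 : X) ∈ C)
    (hgen : ∀ x : X, ∃ y ∈ C, ∃ z ∈ C, x = y - z)
    (hnormal : ∃ δ : ℝ, 0 < δ ∧ ∀ x y : X, x ∈ C → y - x ∈ C → ‖x‖ ≤ δ * ‖y‖)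
    (T : X →L[ℝ] X) (hT : ∀ x ∈ C, T x ∈ C) (h : MBI C (fun x => T x)) :
    ∃ N : ℕ, 0 < N ∧ ‖T ^ N‖ < 1 := by
  obtain ⟨δ, hδ, hn⟩ := hnormal
  obtain ⟨ξ, ⟨⟨-, hmono, hξ0⟩, -⟩, h⟩ := h
  have hc0 : 0 ≤ ξ 1 := by
    have := hmono (by simp) (by simp) (zero_lt_one (α := ℝ))
    linarith
  have hlin : ∀ v ∈ C, ∀ w ∈ C, w - (v - T v) ∈ C → ‖v‖ ≤ ξ 1 * ‖w‖ := by
    intro v hv w hw hvw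
    rcases eq_or_ne w 0 with rfl | hw0
    · have := h v hv 0 hw hvw
      simpa [hξ0] using this
    · have hw1 : 0 < ‖w‖ := norm_pos_iff.mpr hw0
      have hi : 0 ≤ ‖w‖⁻¹ := by positivity
      have := h _ (hsmul _ hi v hv) _ (hsmul _ hi w hw)
        (by simpa only [map_smul, ← smul_sub] using hsmul _ hi _ hvw)
      rw [norm_smul, norm_smul, norm_inv, norm_norm, inv_mul_cancel₀ hw1.ne'] at this
      rwa [inv_mul_le_iff₀ hw1, mul_comm] at this
  have hpow : ∀ n : ℕ, ∀ w ∈ C, (T ^ n) w ∈ C := by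
    intro n w hw
    induction n with
    | zero => simpa using hw
    | succ n ih => rw [pow_succ']; exact hT _ ih
  have hsucc : ∀ n : ℕ, ∀ w, T ((T ^ n) w) = (T ^ (n + 1)) w := by
    intro n w; rw [pow_succ']; rfl
  have hsum : ∀ f : ℕ → X, (∀ k, f k ∈ C) → ∀ n, ∑ k ∈ Finset.range n, f k ∈ C := by
    intro f hf n
    induction n with
    | zero => simpa using h0
    | succ n ih => rw [Finset.sum_range_succ]; exact hadd _ ih _ (hf n)
  have hS : ∀ w ∈ C, ∀ n, ‖∑ k ∈ Finset.range n, (T ^ k) w‖ ≤ ξ 1 * ‖w‖ := by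
    intro w hw n
    refine hlin _ (hsum _ (fun k => hpow k w hw) n) w hw ?_
    have : w - (∑ k ∈ Finset.range n, (T ^ k) w - T (∑ k ∈ Finset.range n, (T ^ k) w))
        = (T ^ n) w := by
      rw [map_sum]
      simp only [hsucc]
      induction n with
      | zero => simp
      | succ n ih =>
        rw [Finset.sum_range_succ, Finset.sum_range_succ]
        rw [← sub_eq_zero] at ih ⊢
        rw [← ih]; abel
    rw [this]; exact hpow n w hw
  have hY : ∀ w ∈ C, ∀ n, ‖∑ k ∈ Finset.range n, ((k : ℝ) + 1) • (T ^ k) w‖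
      ≤ ξ 1 * (ξ 1 * ‖w‖) := by
    intro w hw n
    refine (hlin _ (hsum _ (fun k => hsmul _ (by positivity) _ (hpow k w hw)) n) _
      (hsum _ (fun k => hpow k w hw) n) ?_).trans (mul_le_mul_of_nonneg_left (hS w hw n) hc0)
    have : ∑ k ∈ Finset.range n, (T ^ k) w - (∑ k ∈ Finset.range n, ((k : ℝ) + 1) • (T ^ k) w
          - T (∑ k ∈ Finset.range n, ((k : ℝ) + 1) • (T ^ k) w))
        = (n : ℝ) • (T ^ n) w := by
      rw [map_sum]
      simp only [map_smul, hsucc]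
      induction n with
      | zero => simp
      | succ n ih =>
        rw [Finset.sum_range_succ, Finset.sum_range_succ, Finset.sum_range_succ]
        rw [← sub_eq_zero] at ih ⊢
        rw [← ih]; push_cast; module
    rw [this]; exact hsmul _ (by positivity) _ (hpow n w hw)
  have hZ : ∀ w ∈ C, ∀ n : ℕ, ‖((n : ℝ) + 1) • (T ^ n) w‖ ≤ δ * (ξ 1 * (ξ 1 * ‖w‖)) := by
    intro w hw n
    refine (hn _ (∑ k ∈ Finset.range (n + 1), ((k : ℝ) + 1) • (T ^ k) w)
      (hsmul _ (by positivity) _ (hpow n w hw)) ?_).trans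
      (mul_le_mul_of_nonneg_left (hY w hw _) hδ.le)
    rw [Finset.sum_range_succ, add_sub_cancel_right]
    exact hsum _ (fun k => hsmul _ (by positivity) _ (hpow k w hw)) n
  obtain ⟨B, hB⟩ := banach_steinhaus (g := fun n : ℕ => ((n : ℝ) + 1) • T ^ n) (by
    intro x
    obtain ⟨y, hy, z, hz, rfl⟩ := hgen x
    refine ⟨δ * (ξ 1 * (ξ 1 * ‖y‖)) + δ * (ξ 1 * (ξ 1 * ‖z‖)), fun n => ?_⟩
    have := (norm_sub_le _ _).trans (add_le_add (hZ y hy n) (hZ z hz n))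
    simpa [smul_sub] using this)
  obtain ⟨N, hN⟩ := exists_nat_gt B
  refine ⟨N + 1, N.succ_pos, ?_⟩
  have h1 := hB (N + 1)
  simp only [norm_smul] at h1
  rw [Real.norm_of_nonneg (by positivity)] at h1
  push_cast at h1
  by_contra! h2
  nlinarith [(Nat.cast_nonneg N : (0 : ℝ) ≤ N)]

/-- Ordered Banach space with generating and normal cone `C`, and `A` the
restriction to `C` of a positive bounded linear operator `T`. TFAE: (i) the system
`x(k+1) ≤ A(x(k)) + u(k)` is eISS; (ii) it has the MLIM property; (iii) `id − A` has the
MBI property; (iv) the spectral radius of `T` (the Gelfand limit `lim ‖Tⁿ‖^{1/n}`)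
is `< 1`. -/
theorem linear_positive_operator_stability_tfae
    {X : Type*} [NormedAddCommGroup X] [NormedSpace ℝ X] [CompleteSpace X]
    (C : Set X) (hclosed : IsClosed C)
    (hadd : ∀ x ∈ C, ∀ y ∈ C, x + y ∈ C)
    (hsmul : ∀ r : ℝ, 0 ≤ r → ∀ x ∈ C, r • x ∈ C)
    (hpointed : ∀ x ∈ C, -x ∈ C → x = 0)
    (hgen : ∀ x : X, ∃ y ∈ C, ∃ z ∈ C, x = y - z)
    (hnormal : ∃ δ : ℝ, 0 < δ ∧ ∀ x y : X, x ∈ C → y - x ∈ C → ‖x‖ ≤ δ * ‖y‖)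
    (T : X →L[ℝ] X) (hT : ∀ x ∈ C, T x ∈ C) :
    List.TFAE
      [ EISS C (fun x => T x),
        MLIM C (fun x => T x),
        MBI C (fun x => T x),
        ∃ ρ : ℝ, ρ < 1 ∧
          Filter.Tendsto (fun m : ℕ => ‖T ^ m‖ ^ (1 / (m : ℝ)))
            Filter.atTop (nhds ρ) ] := by
  have h0 : (0 : X) ∈ C := by
    obtain ⟨y, hy, -⟩ := hgen 0
    simpa using hsmul 0 le_rfl y hy
  tfae_have 1 → 2 := aux_i_ii C _
  tfae_have 2 → 3 := aux_ii_iii C _ h0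
  tfae_have 3 → 4 := by
    intro h
    obtain ⟨N, hN, h⟩ := aux_iii_iv C hadd hsmul h0 hgen hnormal T hT h
    exact aux_gelfand T N hN h
  tfae_have 4 → 1 := by
    rintro ⟨ρ, hρ, h⟩
    exact aux_iv_i C hadd hsmul hnormal T hT ρ hρ h
  tfae_finish
end
end

section
/- Let I be a nonempty index set and suppose all gains are linear, γ_ij(r) = c_ij·r with constants c_ij ≥ 0 satisfying sup_{i,j∈I} c_ij < ∞, so that the gain operator Γ_⊗(s) = (sup_{j∈I} c_ij s_j)_{i∈I} is well-defined on ℓ∞(I)⁺. Then the following are equivalent: (i) the operator id − Γ_⊗ has the monotone bounded invertibility (MBI) property; (ii) there exist λ ∈ (0,1) and a point s₀ in the interior of ℓ∞(I)⁺ such that Γ_⊗(s₀) ≤ λs₀; (iii) lim_{n→∞} sup_{s∈ℓ∞(I)⁺, ‖s‖=1} ‖Γ_⊗ⁿ(s)‖^{1/n} = lim_{n→∞} ‖Γ_⊗ⁿ(𝟏)‖^{1/n} < 1; (iv) the discrete-time system w(k+1) ≤ Γ_⊗(w(k)) + v(k) is exponentially input-to-state stable (eISS); (v) the system w(k+1)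 ≤ Γ_⊗(w(k)) + v(k) has the monotone limit (MLIM) property. -/
open Filter Set

noncomputable section

/-- The gain operator with linear gains: `Γ_⊗(s)_i = sup_j c_ij·s_j`. -/
def gainOpMaxLin {I : Type*} (c : I → I → ℝ) (x : I → ℝ) : I → ℝ :=
  fun i => ⨆ j, c i j * x j

/-- MBI property of `id − Γ` on `ℓ∞(I)⁺`. -/
def MBIl {I : Type*} (Γ : (I → ℝ) → I → ℝ) : Prop :=
  ∃ ξ : ℝ → ℝ, IsClassKInf ξ ∧
    ∀ v w : I → ℝ, InLinfPos v → InLinfPos w →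
      (∀ i, v i - Γ v i ≤ w i) → supNorm v ≤ ξ (supNorm w)

/-- MLIM property of the system `x(k+1) ≤ Γ(x(k)) + w` on `ℓ∞(I)⁺`. -/
def MLIMl {I : Type*} (Γ : (I → ℝ) → I → ℝ) : Prop :=
  ∃ ξ : ℝ → ℝ, IsClassKInf ξ ∧
    ∀ ε : ℝ, 0 < ε → ∀ w : I → ℝ, InLinfPos w →
      ∀ x : ℕ → I → ℝ, (∀ k, InLinfPos (x k)) →
        (∀ k i, x (k + 1) i ≤ x k i) →
        (∀ k i, x (k + 1) i ≤ Γ (x k) i + w i) →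
        ∃ N : ℕ, supNorm (x N) ≤ ε + ξ (supNorm w)

/-- eISS of the system `w(k+1) ≤ Γ(w(k)) + v(k)` on `ℓ∞(I)⁺`. -/
def EISSl {I : Type*} (Γ : (I → ℝ) → I → ℝ) : Prop :=
  ∃ M : ℝ, 1 ≤ M ∧ ∃ a : ℝ, 0 < a ∧ a < 1 ∧ ∃ γ : ℝ → ℝ, IsClassKInf γ ∧
    ∀ v : ℕ → I → ℝ, (∀ k, InLinfPos (v k)) →
      BddAbove (Set.range fun k => supNorm (v k)) →
      ∀ w : ℕ → I → ℝ, (∀ k, InLinfPos (w k)) →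
        (∀ k i, w (k + 1) i ≤ Γ (w k) i + v k i) →
        ∀ k, supNorm (w k) ≤ M * supNorm (w 0) * a ^ k + γ (⨆ j, supNorm (v j))

theorem fekete_mul (a : ℕ → ℝ) (h0 : ∀ n, 0 ≤ a n) (hm : ∀ m n, a (m + n) ≤ a m * a n) :
    ∃ ρ : ℝ, Filter.Tendsto (fun m : ℕ => a m ^ (1 / (m : ℝ))) Filter.atTop (nhds ρ) ∧
      ∀ n, 1 ≤ n → ρ ≤ a n ^ (1 / (n : ℝ)) := by
  have hb : BddBelow ((fun m : ℕ => a m ^ (1 / (m : ℝ))) '' Set.Ici 1) := by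
    refine ⟨0, ?_⟩
    rintro _ ⟨m, -, rfl⟩
    exact Real.rpow_nonneg (h0 m) _
  have hne : ((fun m : ℕ => a m ^ (1 / (m : ℝ))) '' Set.Ici 1).Nonempty :=
    ⟨_, ⟨1, by simp, rfl⟩⟩
  have hle : ∀ n, 1 ≤ n → sInf ((fun m : ℕ => a m ^ (1 / (m : ℝ))) '' Set.Ici 1)
      ≤ a n ^ (1 / (n : ℝ)) := fun n hn => csInf_le hb ⟨n, hn, rfl⟩
  refine ⟨_, ?_, hle⟩
  rw [tendsto_order]
  constructor
  · intro L hL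
    filter_upwards [Filter.eventually_ge_atTop 1] with n hn
    exact lt_of_lt_of_le hL (hle n hn)
  · intro L hL
    obtain ⟨_, ⟨n, hn, rfl⟩, hnL⟩ := exists_lt_of_csInf_lt hne hL
    have hn : 1 ≤ n := hn
    have hLpos : 0 < L := lt_of_le_of_lt (Real.rpow_nonneg (h0 n) _) hnL
    by_cases hz : ∃ k, a k = 0
    · obtain ⟨k, hk⟩ := hz
      filter_upwards [Filter.eventually_ge_atTop (k + 1)] with p hp
      have : a p = 0 := by
        apply le_antisymm _ (h0 p)
        have := hm k (p - k)
        rw [hk, zero_mul] at this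
        rwa [show k + (p - k) = p by omega] at this
      rw [this, Real.zero_rpow]
      · exact hLpos
      · have : (0 : ℝ) < p := by exact_mod_cast (by omega : 0 < p)
        positivity
    · have hpos : ∀ k, 0 < a k := fun k =>
        lt_of_le_of_ne (h0 k) (fun h => hz ⟨k, h.symm⟩)
      have hsub : Subadditive (fun n => Real.log (a n)) := by
        intro m n
        rw [← Real.log_mul (hpos m).ne' (hpos n).ne']
        exact Real.log_le_log (hpos _) (hm m n)
      have key : ∀ p : ℕ, (a p ^ (1 / (p : ℝ)) < L ↔ Real.log (a p) / p < Real.log L) := by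
        intro p
        rw [Real.rpow_def_of_pos (hpos p), Real.lt_log_iff_exp_lt hLpos]
        rw [mul_one_div]
      have := hsub.eventually_div_lt_of_div_lt (n := n) (by omega) ((key n).1 hnL)
      filter_upwards [this] with p hp
      exact (key p).2 hp

section aux
variable {I : Type*} [Nonempty I]

theorem le_supNorm {x : I → ℝ} (hx : InLinfPos x) (i : I) : x i ≤ supNorm x :=
  (le_abs_self _).trans (le_ciSup hx.2 i)

theorem supNorm_nonneg' (x : I → ℝ) : 0 ≤ supNorm x :=
  Real.iSup_nonneg fun _ => abs_nonneg _

theorem supNorm_le' {x : I → ℝ} (h0 : ∀ i, 0 ≤ x i) {b : ℝ} (h : ∀ i, x i ≤ b) :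
    supNorm x ≤ b :=
  ciSup_le fun i => by rw [abs_of_nonneg (h0 i)]; exact h i

theorem inLinf_of_le {x : I → ℝ} (h0 : ∀ i, 0 ≤ x i) {b : ℝ} (h : ∀ i, x i ≤ b) :
    InLinfPos x := by
  refine ⟨h0, b, ?_⟩
  rintro _ ⟨i, rfl⟩
  simpa only [abs_of_nonneg (h0 i)] using h i

theorem inLinf_one : InLinfPos (fun _ : I => (1 : ℝ)) :=
  inLinf_of_le (b := 1) (fun _ => zero_le_one) (fun _ => le_rfl)

variable {c : I → I → ℝ} {B : ℝ}

theorem c_bdd (hc : ∀ i j, 0 ≤ c i j) (hB : ∀ i j, c i j ≤ B) {x : I → ℝ} (hx : InLinfPos x)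
    (i : I) : BddAbove (Set.range fun j => c i j * x j) := by
  refine ⟨B * supNorm x, ?_⟩
  rintro _ ⟨j, rfl⟩
  exact mul_le_mul (hB i j) (le_supNorm hx j) (hx.1 j) ((hc i j).trans (hB i j))

theorem le_gain (hc : ∀ i j, 0 ≤ c i j) (hB : ∀ i j, c i j ≤ B) {x : I → ℝ} (hx : InLinfPos x)
    (i j : I) : c i j * x j ≤ gainOpMaxLin c x i :=
  le_ciSup (c_bdd hc hB hx i) j

theorem gain_nonneg (hc : ∀ i j, 0 ≤ c i j) {x : I → ℝ} (hx : InLinfPos x)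
    (i : I) : 0 ≤ gainOpMaxLin c x i :=
  Real.iSup_nonneg fun j => mul_nonneg (hc i j) (hx.1 j)

theorem gain_le (hc : ∀ i j, 0 ≤ c i j) (hB : ∀ i j, c i j ≤ B) {x : I → ℝ} (hx : InLinfPos x)
    (i : I) : gainOpMaxLin c x i ≤ B * supNorm x :=
  ciSup_le fun j => mul_le_mul (hB i j) (le_supNorm hx j) (hx.1 j) ((hc i j).trans (hB i j))

theorem gain_in (hc : ∀ i j, 0 ≤ c i j) (hB : ∀ i j, c i j ≤ B) {x : I → ℝ} (hx : InLinfPos x) :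
    InLinfPos (gainOpMaxLin c x) :=
  inLinf_of_le (gain_nonneg hc hx) (gain_le hc hB hx)

/-- `x ≤ t y` implies `Γ x ≤ t Γ y`. -/
theorem gain_mono (hc : ∀ i j, 0 ≤ c i j) (hB : ∀ i j, c i j ≤ B) {x y : I → ℝ}
    (hy : InLinfPos y) {t : ℝ} (ht : 0 ≤ t) (h : ∀ i, x i ≤ t * y i) (i : I) :
    gainOpMaxLin c x i ≤ t * gainOpMaxLin c y i := by
  refine ciSup_le fun j => ?_
  calc c i j * x j ≤ c i j * (t * y j) := mul_le_mul_of_nonneg_left (h j) (hc i j)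
    _ = t * (c i j * y j) := by ring
    _ ≤ _ := mul_le_mul_of_nonneg_left (le_gain hc hB hy i j) ht

theorem iter_in (hc : ∀ i j, 0 ≤ c i j) (hB : ∀ i j, c i j ≤ B) {x : I → ℝ} (hx : InLinfPos x)
    (n : ℕ) : InLinfPos ((gainOpMaxLin c)^[n] x) := by
  induction n with
  | zero => exact hx
  | succ n ih => rw [Function.iterate_succ_apply']; exact gain_in hc hB ih

theorem iter_mono (hc : ∀ i j, 0 ≤ c i j) (hB : ∀ i j, c i j ≤ B) {x y : I → ℝ}
    (hy : InLinfPos y) {t : ℝ} (ht : 0 ≤ t) (h : ∀ i, x i ≤ t * y i) (n : ℕ) :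
    ∀ i, (gainOpMaxLin c)^[n] x i ≤ t * (gainOpMaxLin c)^[n] y i := by
  induction n with
  | zero => exact h
  | succ n ih =>
    intro i
    rw [Function.iterate_succ_apply', Function.iterate_succ_apply']
    exact gain_mono hc hB (iter_in hc hB hy n) ht ih i

theorem iter_norm (hc : ∀ i j, 0 ≤ c i j) (hB : ∀ i j, c i j ≤ B) {x : I → ℝ}
    (hx : InLinfPos x) (n : ℕ) : supNorm ((gainOpMaxLin c)^[n] x) ≤
      supNorm x * supNorm ((gainOpMaxLin c)^[n] (fun _ => 1)) := by
  refine supNorm_le' (iter_in hc hB hx n).1 fun i => ?_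
  refine (iter_mono hc hB inLinf_one (supNorm_nonneg' x)
    (fun i => by simpa using le_supNorm hx i) n i).trans ?_
  exact mul_le_mul_of_nonneg_left (le_supNorm (iter_in hc hB inLinf_one n) i) (supNorm_nonneg' x)

theorem supNorm_one : supNorm (fun _ : I => (1 : ℝ)) = 1 := by simp [supNorm]

theorem sup_eq (hc : ∀ i j, 0 ≤ c i j) (hB : ∀ i j, c i j ≤ B) (m : ℕ) :
    (⨆ s : {s : I → ℝ // InLinfPos s ∧ supNorm s = 1}, supNorm ((gainOpMaxLin c)^[m] s.1))
      = supNorm ((gainOpMaxLin c)^[m] (fun _ => 1)) := by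
  have hle : ∀ s : {s : I → ℝ // InLinfPos s ∧ supNorm s = 1},
      supNorm ((gainOpMaxLin c)^[m] s.1) ≤ supNorm ((gainOpMaxLin c)^[m] (fun _ => 1)) := by
    intro s
    have := iter_norm hc hB s.2.1 m
    rwa [s.2.2, one_mul] at this
  let o : {s : I → ℝ // InLinfPos s ∧ supNorm s = 1} := ⟨fun _ => 1, inLinf_one, supNorm_one⟩
  haveI : Nonempty {s : I → ℝ // InLinfPos s ∧ supNorm s = 1} := ⟨o⟩
  refine le_antisymm (ciSup_le hle) ?_
  exact le_ciSup (f := fun s : {s : I → ℝ // InLinfPos s ∧ supNorm s = 1} =>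
    supNorm ((gainOpMaxLin c)^[m] s.1)) ⟨_, by rintro _ ⟨s, rfl⟩; exact hle s⟩ o

/-- Simplified form of (ii). -/
def PtDecay (c : I → I → ℝ) : Prop :=
  ∃ lam : ℝ, 0 < lam ∧ lam < 1 ∧ ∃ s₀ : I → ℝ, InLinfPos s₀ ∧
    (∃ δ : ℝ, 0 < δ ∧ ∀ i, δ ≤ s₀ i) ∧ ∀ i, gainOpMaxLin c s₀ i ≤ lam * s₀ i

theorem ptDecay_of_seq (u : ℕ → I → ℝ) (K r : ℝ) (hr : 0 < r) (hr1 : r < 1)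
    (h1 : ∀ i, 1 ≤ u 0 i) (hK : ∀ n i, u n i ≤ K) (hc : ∀ i j, 0 ≤ c i j)
    (hstep : ∀ n i j, c i j * u n j ≤ r * u (n + 1) i) : PtDecay c := by
  have hb : ∀ i, BddAbove (Set.range fun n => u n i) := fun i =>
    ⟨K, by rintro _ ⟨n, rfl⟩; exact hK n i⟩
  have hge : ∀ i, 1 ≤ ⨆ n, u n i := fun i => (h1 i).trans (le_ciSup (hb i) 0)
  refine ⟨r, hr, hr1, fun i => ⨆ n, u n i, ?_, ⟨1, one_pos, hge⟩, ?_⟩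
  · exact inLinf_of_le (b := K) (fun i => zero_le_one.trans (hge i)) (fun i => ciSup_le (hK · i))
  · intro i
    refine ciSup_le fun j => ?_
    rw [Real.mul_iSup_of_nonneg (hc i j)]
    refine ciSup_le fun n => (hstep n i j).trans ?_
    exact mul_le_mul_of_nonneg_left (le_ciSup (hb i) (n + 1)) hr.le

theorem linK {a : ℝ} (ha : 0 < a) : IsClassKInf (fun r => a * r) := by
  refine ⟨⟨by fun_prop, ?_, by simp⟩, Filter.tendsto_id.const_mul_atTop ha⟩
  intro x _ y _ h
  exact mul_lt_mul_of_pos_left h ha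

theorem ptDecay_iff : PtDecay c ↔ ∃ lam : ℝ, 0 < lam ∧ lam < 1 ∧ ∃ s₀ : I → ℝ, InLinfPos s₀ ∧
          (∃ ε : ℝ, 0 < ε ∧ ∀ y : I → ℝ,
            BddAbove (Set.range fun i => |y i - s₀ i|) →
            supNorm (fun i => y i - s₀ i) < ε → ∀ i, 0 ≤ y i) ∧
          ∀ i, gainOpMaxLin c s₀ i ≤ lam * s₀ i := by
  constructor
  · rintro ⟨l, h0, h1, s, hs, ⟨δ, hδ, hsδ⟩, h⟩
    refine ⟨l, h0, h1, s, hs, ⟨δ, hδ, fun y hy hyn i => ?_⟩, h⟩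
    have h3 : |y i - s i| ≤ supNorm (fun i => y i - s i) := le_ciSup hy i
    have := neg_abs_le (y i - s i)
    linarith [hsδ i]
  · rintro ⟨l, h0, h1, s, hs, ⟨ε, hε, hsε⟩, h⟩
    refine ⟨l, h0, h1, s, hs, ⟨ε / 2, by positivity, fun i => ?_⟩, h⟩
    have e : ∀ i, |(s i - ε / 2) - s i| = ε / 2 := fun i => by
      rw [sub_sub_cancel_left, abs_neg, abs_of_pos (by positivity)]
    have := hsε (fun i => s i - ε / 2) ⟨ε / 2, by rintro _ ⟨i, rfl⟩; exact (e i).le⟩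
      (by simp only [supNorm, e, ciSup_const]; linarith) i
    linarith

theorem decay_to_spec (hc : ∀ i j, 0 ≤ c i j) (hB : ∀ i j, c i j ≤ B) (h : PtDecay c) :
    ∃ ρ : ℝ, ρ < 1 ∧ Filter.Tendsto
      (fun m : ℕ => (supNorm ((gainOpMaxLin c)^[m] (fun _ => 1))) ^ (1 / (m : ℝ)))
            Filter.atTop (nhds ρ) := by
  obtain ⟨l, h0, h1, s, hs, ⟨δ, hδ, hsδ⟩, h⟩ := h
  obtain ⟨ρ, hρ, hρle⟩ := fekete_mul (fun m => supNorm ((gainOpMaxLin c)^[m] (fun _ => 1)))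
    (fun _ => supNorm_nonneg' _) (fun m n => by
      rw [add_comm m n]
      simp only [Function.iterate_add_apply]
      have := iter_norm hc hB (iter_in hc hB inLinf_one m) n
      simpa using this)
  refine ⟨ρ, ?_, hρ⟩
  have hit : ∀ n i, (gainOpMaxLin c)^[n] s i ≤ l ^ n * s i := by
    intro n
    induction n with
    | zero => intro i; simp
    | succ n ih =>
      intro i
      rw [Function.iterate_succ_apply']
      refine (gain_mono hc hB hs (by positivity) ih i).trans ?_
      rw [pow_succ, mul_assoc]
      exact mul_le_mul_of_nonneg_left (h i) (by positivity)
  have hbd : ∀ n, supNorm ((gainOpMaxLin c)^[n] (fun _ => 1)) ≤ δ⁻¹ * supNorm s * l ^ n := by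
    intro n
    refine supNorm_le' (iter_in hc hB inLinf_one n).1 fun i => ?_
    refine (iter_mono hc hB hs (t := δ⁻¹) (by positivity) (fun i => ?_) n i).trans ?_
    · rw [inv_mul_eq_div, le_div_iff₀ hδ, one_mul]; exact hsδ i
    · rw [mul_assoc]
      refine mul_le_mul_of_nonneg_left ((hit n i).trans ?_) (by positivity)
      rw [mul_comm]
      exact mul_le_mul_of_nonneg_right (le_supNorm hs i) (by positivity)
  have ht : Filter.Tendsto (fun n : ℕ => δ⁻¹ * supNorm s * l ^ n) Filter.atTop (nhds 0) := by
    simpa using (tendsto_pow_atTop_nhds_zero_of_lt_one h0.le h1).const_mul (δ⁻¹ * supNorm s)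
  obtain ⟨n, hn1, hn⟩ := ((Filter.eventually_ge_atTop 1).and
    (ht.eventually (gt_mem_nhds one_pos))).exists
  refine (hρle n hn1).trans_lt ?_
  have : (0 : ℝ) < n := by exact_mod_cast hn1
  exact Real.rpow_lt_one (supNorm_nonneg' _) ((hbd n).trans_lt hn) (by positivity)

theorem spec_to_decay (hc : ∀ i j, 0 ≤ c i j) (hB : ∀ i j, c i j ≤ B) {ρ : ℝ} (hρ : ρ < 1)
    (h : Filter.Tendsto
      (fun m : ℕ => (supNorm ((gainOpMaxLin c)^[m] (fun _ => 1))) ^ (1 / (m : ℝ)))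
            Filter.atTop (nhds ρ)) : PtDecay c := by
  have hρ0 : 0 ≤ ρ := ge_of_tendsto' h fun m => Real.rpow_nonneg (supNorm_nonneg' _) _
  obtain ⟨r, hr, hr1⟩ := exists_between hρ
  have hr0 : 0 < r := hρ0.trans_lt hr
  have hev : ∀ᶠ m : ℕ in Filter.atTop,
      r⁻¹ ^ m * supNorm ((gainOpMaxLin c)^[m] (fun _ => 1)) ≤ 1 := by
    filter_upwards [h.eventually (gt_mem_nhds hr), Filter.eventually_ge_atTop 1] with m hm hm1
    have hmp : (0 : ℝ) < m := by exact_mod_cast hm1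
    have h2 : supNorm ((gainOpMaxLin c)^[m] (fun _ => 1)) ≤ r ^ m := by
      rw [one_div] at hm
      have := (Real.rpow_inv_le_iff_of_pos (supNorm_nonneg' _) hr0.le hmp).1 hm.le
      rwa [Real.rpow_natCast] at this
    rw [inv_pow, inv_mul_eq_div, div_le_one (by positivity)]
    exact h2
  obtain ⟨K, hK⟩ : ∃ K, ∀ m : ℕ, r⁻¹ ^ m * supNorm ((gainOpMaxLin c)^[m] (fun _ => 1)) ≤ K := by
    have : Filter.IsBoundedUnder (· ≤ ·) Filter.atTop
      (fun m : ℕ => r⁻¹ ^ m * supNorm ((gainOpMaxLin c)^[m] (fun _ => 1))) := ⟨1, hev⟩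
    obtain ⟨K, hK⟩ := this.bddAbove_range
    exact ⟨K, fun m => hK ⟨m, rfl⟩⟩
  refine ptDecay_of_seq (fun n i => r⁻¹ ^ n * (gainOpMaxLin c)^[n] (fun _ => 1) i) K r hr0 hr1
    (by simp) (fun n i => ?_) hc (fun n i j => ?_)
  · exact (mul_le_mul_of_nonneg_left (le_supNorm (iter_in hc hB inLinf_one n) i)
      (by positivity)).trans (hK n)
  · rw [Function.iterate_succ_apply', pow_succ]
    have := le_gain hc hB (iter_in hc hB inLinf_one n) i j
    calc _ = r⁻¹ ^ n * (c i j * (gainOpMaxLin c)^[n] (fun _ => 1) j) := by ring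
      _ ≤ r⁻¹ ^ n * gainOpMaxLin c ((gainOpMaxLin c)^[n] (fun _ => 1)) i :=
        mul_le_mul_of_nonneg_left this (by positivity)
      _ = _ := by field_simp

theorem decay_to_eiss (hc : ∀ i j, 0 ≤ c i j) (hB : ∀ i j, c i j ≤ B) (h : PtDecay c) :
    EISSl (gainOpMaxLin c) := by
  obtain ⟨l, h0, h1, s, hs, ⟨δ, hδ, hsδ⟩, h⟩ := h
  have hl : 0 < 1 - l := by linarith
  have hKδ : δ ≤ supNorm s := by
    obtain ⟨i⟩ := ‹Nonempty I›
    exact (hsδ i).trans (le_supNorm hs i)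
  have hK : 0 < supNorm s := hδ.trans_le hKδ
  refine ⟨supNorm s / δ, by rwa [le_div_iff₀ hδ, one_mul], l, h0, h1,
    fun r => (supNorm s / (δ * (1 - l))) * r, linK (by positivity), ?_⟩
  intro v hv hvb w hw hstep k
  set V := ⨆ j, supNorm (v j) with hV
  have hV0 : 0 ≤ V := Real.iSup_nonneg fun j => supNorm_nonneg' _
  have hvV : ∀ k i, v k i ≤ V := fun k i => (le_supNorm (hv k) i).trans (le_ciSup hvb k)
  have hw0 := supNorm_nonneg' (w 0)
  have hind : ∀ k i, w k i ≤ (supNorm (w 0) / δ * l ^ k + V / (δ * (1 - l))) * s i := by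
    intro k
    induction k with
    | zero =>
      intro i
      have h3 := le_supNorm (hw 0) i
      have h4 : supNorm (w 0) ≤ supNorm (w 0) / δ * s i := by
        rw [div_mul_eq_mul_div, le_div_iff₀ hδ]
        exact mul_le_mul_of_nonneg_left (hsδ i) hw0
      have h5 : 0 ≤ V / (δ * (1 - l)) * s i := mul_nonneg (by positivity) (hs.1 i)
      rw [pow_zero, mul_one, add_mul]; linarith
    | succ k ih =>
      intro i
      have h3 := hstep k i
      have ht : 0 ≤ supNorm (w 0) / δ * l ^ k + V / (δ * (1 - l)) := by positivity
      have h4 := gain_mono hc hB hs ht ih i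
      have h5 := mul_le_mul_of_nonneg_left (h i) ht
      have h6 : V ≤ V / δ * s i := by
        rw [div_mul_eq_mul_div, le_div_iff₀ hδ]
        exact mul_le_mul_of_nonneg_left (hsδ i) hV0
      have h7 := hvV k i
      have h8 : (supNorm (w 0) / δ * l ^ (k + 1) + V / (δ * (1 - l))) * s i
        = (supNorm (w 0) / δ * l ^ k + V / (δ * (1 - l))) * (l * s i) + V / δ * s i := by
        field_simp
        ring
      rw [h8]; linarith
  refine supNorm_le' (hw k).1 fun i => (hind k i).trans ?_
  refine (mul_le_mul_of_nonneg_left (le_supNorm hs i) (by positivity)).trans (le_of_eq ?_)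
  field_simp

theorem eiss_to_mlim {Γ : (I → ℝ) → I → ℝ} (h : EISSl Γ) : MLIMl Γ := by
  obtain ⟨M, hM, a, ha0, ha1, γ, hγ, h⟩ := h
  refine ⟨γ, hγ, fun ε hε w hw x hx hdec hstep => ?_⟩
  have h2 := h (fun _ => w) (fun _ => hw) (by simp) x hx hstep
  simp only [ciSup_const] at h2
  have ht : Filter.Tendsto (fun n : ℕ => M * supNorm (x 0) * a ^ n) Filter.atTop (nhds 0) := by
    simpa using (tendsto_pow_atTop_nhds_zero_of_lt_one ha0.le ha1).const_mul (M * supNorm (x 0))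
  obtain ⟨n, hn⟩ := (ht.eventually (gt_mem_nhds hε)).exists
  exact ⟨n, (h2 n).trans (by linarith)⟩

theorem mlim_to_mbi {Γ : (I → ℝ) → I → ℝ} (h : MLIMl Γ) : MBIl Γ := by
  obtain ⟨ξ, hξ, h⟩ := h
  refine ⟨ξ, hξ, fun v w hv hw hvw => le_of_forall_pos_le_add fun ε hε => ?_⟩
  obtain ⟨N, hN⟩ := h ε hε w hw (fun _ => v) (fun _ => hv) (fun _ _ => le_rfl)
    (fun _ i => by linarith [hvw i])
  linarith

theorem mbi_to_decay (hc : ∀ i j, 0 ≤ c i j) (hB : ∀ i j, c i j ≤ B) (h : MBIl (gainOpMaxLin c)) :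
    PtDecay c := by
  obtain ⟨ξ, hξ, h⟩ := h
  have hC : 0 < ξ 1 := by
    have := hξ.1.2.1 (show (0 : ℝ) ∈ Set.Ici 0 by simp) (show (1 : ℝ) ∈ Set.Ici 0 by simp) one_pos
    rwa [hξ.1.2.2] at this
  set C := ξ 1 with hCdef
  have hB0 : 0 ≤ B := by
    obtain ⟨i⟩ := ‹Nonempty I›
    exact (hc i i).trans (hB i i)
  -- linear bound
  have hlin : ∀ v : I → ℝ, InLinfPos v → ∀ t : ℝ, 0 < t →
      (∀ i, v i - gainOpMaxLin c v i ≤ t) → supNorm v ≤ C * t := by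
    intro v hv t ht hvt
    have hin : InLinfPos (fun i => t⁻¹ * v i) :=
      inLinf_of_le (b := t⁻¹ * supNorm v) (fun i => mul_nonneg (by positivity) (hv.1 i))
        (fun i => mul_le_mul_of_nonneg_left (le_supNorm hv i) (by positivity))
    have h3 := h (fun i => t⁻¹ * v i) (fun _ => 1) hin inLinf_one (fun i => by
      have h4 := gain_mono hc hB hin (x := v) ht.le (fun i => by
        rw [← mul_assoc, mul_inv_cancel₀ ht.ne', one_mul]) i
      have h5 := hvt i
      have h6 : t * (t⁻¹ * v i - gainOpMaxLin c (fun i => t⁻¹ * v i) i) ≤ t * 1 := by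
        rw [mul_sub, ← mul_assoc, mul_inv_cancel₀ ht.ne', one_mul]; linarith
      exact le_of_mul_le_mul_left h6 ht)
    rw [supNorm_one] at h3
    refine supNorm_le' hv.1 fun i => ?_
    have h4 := (le_supNorm hin i).trans h3
    rw [inv_mul_eq_div, div_le_iff₀ ht] at h4
    exact h4
  -- choice of the dilation
  set η : ℝ := 1 / (2 * C * (B + 1)) with hη
  have hη0 : 0 < η := by positivity
  have hηC : C * η * B ≤ 1 / 2 := by
    rw [hη]
    have : C * (1 / (2 * C * (B + 1))) * B = 1 / 2 * (B / (B + 1)) := by field_simp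
    rw [this]
    have : B / (B + 1) ≤ 1 := by rw [div_le_one (by positivity)]; linarith
    linarith
  let T : (I → ℝ) → I → ℝ := fun v i => max 1 ((1 + η) * gainOpMaxLin c v i)
  let u : ℕ → I → ℝ := fun n => T^[n] (fun _ => 1)
  have hus : ∀ n, u (n + 1) = T (u n) := fun n => Function.iterate_succ_apply' _ _ _
  have hin : ∀ n, InLinfPos (u n) := by
    intro n
    induction n with
    | zero => exact inLinf_one
    | succ n ih =>
      rw [hus]
      refine inLinf_of_le (b := max 1 ((1 + η) * (B * supNorm (u n))))
        (fun i => zero_le_one.trans (le_max_left _ _)) (fun i => ?_)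
      exact max_le_max le_rfl (mul_le_mul_of_nonneg_left (gain_le hc hB ih i) (by positivity))
  have hmono : ∀ n i, u n i ≤ u (n + 1) i := by
    intro n
    induction n with
    | zero => intro i; rw [hus]; exact le_max_left _ _
    | succ n ih =>
      intro i
      rw [hus (n + 1)]
      nth_rewrite 1 [hus n]
      refine max_le_max le_rfl (mul_le_mul_of_nonneg_left ?_ (by positivity))
      have := gain_mono hc hB (hin (n + 1)) zero_le_one (fun i => by simpa using ih i) i
      simpa using this
  have hbd : ∀ n, supNorm (u n) ≤ 2 * C := by
    intro n
    have hn0 := supNorm_nonneg' (u n)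
    have h3 := hlin (u n) (hin n) (1 + η * (B * supNorm (u n))) (by positivity) (fun i => by
      have h4 := hmono n i
      rw [hus] at h4
      have h5 := gain_nonneg hc (hin n) i
      have h6 := mul_le_mul_of_nonneg_left (gain_le hc hB (hin n) i) hη0.le
      have h7 := mul_nonneg hη0.le h5
      have h8 : T (u n) i ≤ 1 + (1 + η) * gainOpMaxLin c (u n) i :=
        max_le (by nlinarith) (by linarith)
      linarith)
    have h4 := mul_le_mul_of_nonneg_right hηC hn0
    nlinarith
  refine ptDecay_of_seq u (2 * C) (1 + η)⁻¹ (by positivity) (inv_lt_one_of_one_lt₀ (by linarith))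
    (fun i => le_rfl) (fun n i => (le_supNorm (hin n) i).trans (hbd n)) hc (fun n i j => ?_)
  rw [inv_mul_eq_div, le_div_iff₀ (by positivity), hus, mul_comm]
  exact (mul_le_mul_of_nonneg_left (le_gain hc hB (hin n) i j) (by positivity)).trans
    (le_max_right _ _)

end aux

/-- For linear gains `γ_ij(r) = c_ij r` with `sup_{i,j} c_ij < ∞`, TFAE:
(i) `id − Γ_⊗` has the MBI property; (ii) there are `λ ∈ (0,1)` and `s₀` in the interior
of `ℓ∞(I)⁺` with `Γ_⊗(s₀) ≤ λs₀`; (iii) the spectral radius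
`lim_n sup_{‖s‖=1, s ≥ 0} ‖Γ_⊗ⁿ(s)‖^{1/n} = lim_n ‖Γ_⊗ⁿ(𝟏)‖^{1/n}` is `< 1`;
(iv) the induced discrete-time system is eISS; (v) it has the MLIM property. -/
theorem linear_max_gain_operator_tfae
    {I : Type*} [Nonempty I] (c : I → I → ℝ)
    (hc : ∀ i j, 0 ≤ c i j)
    (hbdd : BddAbove (Set.range fun p : I × I => c p.1 p.2)) :
    List.TFAE
      [ MBIl (gainOpMaxLin c),
        ∃ lam : ℝ, 0 < lam ∧ lam < 1 ∧ ∃ s₀ : I → ℝ, InLinfPos s₀ ∧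
          (∃ ε : ℝ, 0 < ε ∧ ∀ y : I → ℝ,
            BddAbove (Set.range fun i => |y i - s₀ i|) →
            supNorm (fun i => y i - s₀ i) < ε → ∀ i, 0 ≤ y i) ∧
          ∀ i, gainOpMaxLin c s₀ i ≤ lam * s₀ i,
        ∃ ρ : ℝ, ρ < 1 ∧
          Filter.Tendsto
            (fun m : ℕ => (⨆ s : {s : I → ℝ // InLinfPos s ∧ supNorm s = 1},
              supNorm ((gainOpMaxLin c)^[m] s.1)) ^ (1 / (m : ℝ)))
            Filter.atTop (nhds ρ) ∧
          Filter.Tendsto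
            (fun m : ℕ => (supNorm ((gainOpMaxLin c)^[m] (fun _ => 1))) ^ (1 / (m : ℝ)))
            Filter.atTop (nhds ρ),
        EISSl (gainOpMaxLin c),
        MLIMl (gainOpMaxLin c) ] := by
  obtain ⟨B, hB'⟩ := hbdd
  have hB : ∀ i j, c i j ≤ B := fun i j => hB' ⟨(i, j), rfl⟩
  rw [← ptDecay_iff]
  simp only [sup_eq hc hB]
  tfae_have 1 → 2 := mbi_to_decay hc hB
  tfae_have 2 → 3 := fun h => by
    obtain ⟨ρ, h1, h2⟩ := decay_to_spec hc hB h
    exact ⟨ρ, h1, h2, h2⟩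
  tfae_have 3 → 2 := fun ⟨ρ, h1, h2, _⟩ => spec_to_decay hc hB h1 h2
  tfae_have 2 → 4 := decay_to_eiss hc hB
  tfae_have 4 → 5 := eiss_to_mlim
  tfae_have 5 → 1 := mlim_to_mbi
  tfae_finish
end
end

section
/- Let (X, X⁺) be an ordered Banach space with a generating and normal cone X⁺, and let A : X⁺ → X⁺ be monotone, homogeneous of degree one (A(rx) = rA(x) for all x ∈ X⁺, r ≥ 0), subadditive (A(x + y) ≤ A(x) + A(y) for all x, y ∈ X⁺), and satisfy C := sup_{x∈X⁺, ‖x‖=1} ‖A(x)‖ < ∞. Then A is globally Lipschitz continuous, and the following are equivalent: (a) the discrete-time system x(k+1) ≤ A(x(k)) + u(k) is exponentially input-to-state stable (eISS); (b) the limit r(A) := lim_{n→∞} sup_{x∈X⁺, ‖x‖=1} ‖Aⁿ(x)‖^{1/n} exists and satisfies r(A) < 1; (c) there exist a globally Lipschitz function V : X⁺ → [0,∞), constants L₁, L₂, ψ > 0 and η > 1 such that L₁‖x‖ ≤ V(x) ≤ L₂‖x‖ for all x ∈ X⁺, and for every bounded input u : ℕ → X⁺ and every solution x of x(k+1) ≤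 A(x(k)) + u(k) one has V(x(k+1)) ≤ η⁻¹V(x(k)) + ψ·sup_j ‖u(j)‖ for all k ≥ 0. -/
open Filter Set

noncomputable section

open Topology

lemma aux_gen {X : Type*} [NormedAddCommGroup X] [NormedSpace ℝ X] [CompleteSpace X]
    (C : Set X) (hclosed : IsClosed C)
    (hadd : ∀ x ∈ C, ∀ y ∈ C, x + y ∈ C)
    (hsmul : ∀ r : ℝ, 0 ≤ r → ∀ x ∈ C, r • x ∈ C)
    (hgen : ∀ x : X, ∃ y ∈ C, ∃ z ∈ C, x = y - z) :
    ∃ κ : ℝ, 0 < κ ∧ ∀ x : X, ∃ y ∈ C, ∃ z ∈ C, x = y - z ∧ ‖y‖ ≤ κ * ‖x‖ ∧ ‖z‖ ≤ κ * ‖x‖ := by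
  classical
  have h0 : (0 : X) ∈ C := by
    obtain ⟨y, hy, -⟩ := hgen 0
    simpa using hsmul 0 le_rfl y hy
  let ι := {c : X // c ∈ C ∧ ‖c‖ ≤ 1}
  have hsn : ∀ f : lp (fun _ : ι => ℝ) 1, Summable fun i => |f i| := by
    intro f
    have := (lp.memℓp f).summable (by norm_num)
    simpa using this
  have hnorm : ∀ f : lp (fun _ : ι => ℝ) 1, ‖f‖ = ∑' i, |f i| := by
    intro f
    rw [lp.norm_eq_tsum_rpow (by norm_num)]
    simp
  -- a general bound
  have hgs : ∀ f : lp (fun _ : ι => ℝ) 1, ∀ g : ι → ℝ, (∀ i, |g i| ≤ |f i|) →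
      Summable (fun i => g i • i.1) ∧ ‖∑' i, g i • i.1‖ ≤ ‖f‖ := by
    intro f g hg
    have hb : ∀ i : ι, ‖g i • i.1‖ ≤ |f i| := by
      intro i
      rw [norm_smul, Real.norm_eq_abs]
      calc |g i| * ‖i.1‖ ≤ |g i| * 1 := by
            gcongr
            exact i.2.2
        _ ≤ |f i| := by simpa using hg i
    refine ⟨Summable.of_norm_bounded (hsn f) hb, ?_⟩
    rw [hnorm]
    exact tsum_of_norm_bounded (hsn f).hasSum hb
  let T0 : lp (fun _ : ι => ℝ) 1 →ₗ[ℝ] X :=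
    { toFun := fun f => ∑' i, f i • i.1
      map_add' := by
        intro f g
        rw [← (hgs f f (fun _ => le_rfl)).1.tsum_add (hgs g g (fun _ => le_rfl)).1]
        simp [add_smul]
      map_smul' := by
        intro r f
        rw [RingHom.id_apply, ← (hgs f f (fun _ => le_rfl)).1.tsum_const_smul]
        simp [mul_smul] }
  let T : lp (fun _ : ι => ℝ) 1 →L[ℝ] X := T0.mkContinuous 1 (by
    intro f
    rw [one_mul]
    exact (hgs f f (fun _ => le_rfl)).2)
  have hT : ∀ f, T f = ∑' i, f i • i.1 := fun f => rfl
  have hcone : ∀ y ∈ C, ∃ f, T f = y := by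
    intro y hy
    by_cases hy0 : y = 0
    · exact ⟨0, by simp [hy0]⟩
    have hn : ‖y‖ ≠ 0 := norm_ne_zero_iff.mpr hy0
    let i0 : ι := ⟨‖y‖⁻¹ • y, hsmul _ (by positivity) y hy, by
      rw [norm_smul, norm_inv, norm_norm, inv_mul_cancel₀ hn]⟩
    refine ⟨lp.single 1 i0 ‖y‖, ?_⟩
    rw [hT, tsum_eq_single i0]
    · simp [i0, smul_smul, hn]
    · intro j hj
      simp [lp.single_apply, Pi.single_apply, hj]
  have hsurj : Function.Surjective T := by
    intro x
    obtain ⟨y, hy, z, hz, rfl⟩ := hgen x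
    obtain ⟨f, hf⟩ := hcone y hy
    obtain ⟨g, hg⟩ := hcone z hz
    exact ⟨f - g, by rw [map_sub, hf, hg]⟩
  obtain ⟨κ, hκ, h⟩ := T.exists_preimage_norm_le hsurj
  refine ⟨κ, hκ, fun x => ?_⟩
  obtain ⟨f, hf, hfx⟩ := h x
  have hmem : ∀ g : ι → ℝ, (∀ i, 0 ≤ g i) → Summable (fun i => g i • i.1) →
      ∑' i, g i • i.1 ∈ C := by
    intro g hg hs
    refine hclosed.mem_of_tendsto hs.hasSum (Eventually.of_forall fun s => ?_)
    induction s using Finset.induction_on with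
    | empty => simpa using h0
    | insert a s ha ih =>
      rw [Finset.sum_insert ha]
      exact hadd _ (hsmul _ (hg a) _ a.2.1) _ ih
  have hp := hgs f (fun i => max (f i) 0) (fun i => by
    rcases le_total (f i) 0 with h | h <;> simp [h])
  have hm := hgs f (fun i => max (-f i) 0) (fun i => by
    rcases le_total (f i) 0 with h | h <;> simp [h])
  refine ⟨_, hmem _ (fun i => le_max_right _ _) hp.1, _,
    hmem _ (fun i => le_max_right _ _) hm.1, ?_, hp.2.trans hfx, hm.2.trans hfx⟩
  rw [← hp.1.tsum_sub hm.1, ← hf, hT]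
  congr 1
  ext i
  rw [← sub_smul]
  congr 1
  rcases le_total (f i) 0 with h | h <;> simp [h]

/-- Fekete type lemma. -/
lemma aux_fekete (s : ℕ → ℝ) (h0 : ∀ n, 0 ≤ s n) (hs : ∀ m n, s (m + n) ≤ s m * s n)
    (h1 : ∃ N, 1 ≤ N ∧ s N < 1) :
    ∃ r < 1, Tendsto (fun m : ℕ => s m ^ (1 / (m : ℝ))) atTop (𝓝 r) := by
  let S := (fun n : ℕ => s n ^ (1 / (n : ℝ))) '' Ici 1
  have hbdd : BddBelow S := ⟨0, by
    rintro _ ⟨n, -, rfl⟩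
    exact Real.rpow_nonneg (h0 n) _⟩
  have hne : S.Nonempty := ⟨_, 1, by simp, rfl⟩
  have hL0 : 0 ≤ sInf S := le_csInf hne (by
    rintro _ ⟨n, -, rfl⟩
    exact Real.rpow_nonneg (h0 n) _)
  refine ⟨sInf S, ?_, ?_⟩
  · obtain ⟨N, hN, hN1⟩ := h1
    refine (csInf_le hbdd ⟨N, hN, rfl⟩).trans_lt ?_
    have : (0 : ℝ) < N := by exact_mod_cast hN
    exact Real.rpow_lt_one (h0 N) hN1 (by positivity)
  · rw [tendsto_order]
    constructor
    · intro b hb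
      filter_upwards [eventually_ge_atTop 1] with n hn
      exact hb.trans_le (csInf_le hbdd ⟨n, hn, rfl⟩)
    · intro b hb
      obtain ⟨ρ, hρ1, hρ2⟩ := exists_between hb
      have hρ0 : 0 < ρ := hL0.trans_lt hρ1
      obtain ⟨_, ⟨N, hN, rfl⟩, hNρ⟩ := exists_lt_of_csInf_lt hne hρ1
      have hN1 : 1 ≤ N := hN
      have hNpos : (0 : ℝ) < N := by exact_mod_cast hN1
      have hsN : s N ≤ ρ ^ N := by
        have := Real.rpow_le_rpow (Real.rpow_nonneg (h0 N) _) hNρ.le hNpos.le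
        rw [← Real.rpow_mul (h0 N), one_div, inv_mul_cancel₀ hNpos.ne', Real.rpow_one,
          Real.rpow_natCast] at this
        exact this
      let D : ℝ := 1 + ∑ i ∈ Finset.range N, s i / ρ ^ i
      have hD : 0 < D := by
        have : 0 ≤ ∑ i ∈ Finset.range N, s i / ρ ^ i :=
          Finset.sum_nonneg fun i _ => div_nonneg (h0 i) (by positivity)
        simp only [D]; linarith
      have key : ∀ n, s n ≤ D * ρ ^ n := by
        intro n
        induction n using Nat.strong_induction_on with
        | _ n ih =>
          by_cases hn : n < N
          · have : s n / ρ ^ n ≤ D := by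
              have := Finset.single_le_sum (f := fun i => s i / ρ ^ i)
                (fun i _ => div_nonneg (h0 i) (by positivity)) (Finset.mem_range.mpr hn)
              simp only [D]; linarith
            rwa [div_le_iff₀ (by positivity)] at this
          · obtain ⟨m, rfl⟩ := Nat.exists_eq_add_of_le (not_lt.mp hn)
            calc s (N + m) ≤ s N * s m := hs N m
              _ ≤ ρ ^ N * (D * ρ ^ m) := by
                gcongr
                · exact h0 m
                · exact ih m (by omega)
              _ = D * ρ ^ (N + m) := by ring
      have hlim : Tendsto (fun n : ℕ => D ^ (1 / (n : ℝ)) * ρ) atTop (𝓝 (D ^ (0:ℝ) * ρ)) := by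
        refine Tendsto.mul_const _ ?_
        exact (Real.continuousAt_const_rpow hD.ne').tendsto.comp (tendsto_one_div_atTop_nhds_zero_nat (𝕜 := ℝ))
      rw [Real.rpow_zero, one_mul] at hlim
      filter_upwards [hlim.eventually_lt_const hρ2, eventually_ge_atTop 1] with n hn hn1
      refine lt_of_le_of_lt ?_ hn
      have hnpos : (0 : ℝ) < n := by exact_mod_cast hn1
      calc s n ^ (1 / (n : ℝ)) ≤ (D * ρ ^ n) ^ (1 / (n : ℝ)) :=
            Real.rpow_le_rpow (h0 n) (key n) (by positivity)
        _ = D ^ (1 / (n : ℝ)) * ρ := by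
            rw [Real.mul_rpow hD.le (by positivity), ← Real.rpow_natCast, ← Real.rpow_mul hρ0.le,
              mul_one_div_cancel hnpos.ne', Real.rpow_one]

/-- Ordered Banach space with generating and normal cone; `A : X⁺ → X⁺`
monotone, homogeneous of degree one, subadditive, with
`C := sup_{x∈X⁺,‖x‖=1} ‖A(x)‖ < ∞`. Then `A` is globally Lipschitz, and TFAE:
(a) the induced discrete-time system is eISS;
(b) `r(A) := lim_n sup_{x∈X⁺,‖x‖=1} ‖Aⁿ(x)‖^{1/n}` exists and is `< 1`;
(c) there is a globally Lipschitz `V` with `L₁‖x‖ ≤ V(x) ≤ L₂‖x‖` and the exponential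
decay dissipation inequality along all solutions. -/
theorem homogeneous_subadditive_eISS_tfae
    {X : Type*} [NormedAddCommGroup X] [NormedSpace ℝ X] [CompleteSpace X]
    (C : Set X) (hclosed : IsClosed C)
    (hadd : ∀ x ∈ C, ∀ y ∈ C, x + y ∈ C)
    (hsmul : ∀ r : ℝ, 0 ≤ r → ∀ x ∈ C, r • x ∈ C)
    (hpointed : ∀ x ∈ C, -x ∈ C → x = 0)
    (hgen : ∀ x : X, ∃ y ∈ C, ∃ z ∈ C, x = y - z)
    (hnormal : ∃ δ : ℝ, 0 < δ ∧ ∀ x y : X, x ∈ C → y - x ∈ C → ‖x‖ ≤ δ * ‖y‖)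
    (A : X → X) (hA : ∀ x ∈ C, A x ∈ C)
    (hmono : ∀ x ∈ C, ∀ y ∈ C, y - x ∈ C → A y - A x ∈ C)
    (hhomog : ∀ x ∈ C, ∀ r : ℝ, 0 ≤ r → A (r • x) = r • A x)
    (hsubadd : ∀ x ∈ C, ∀ y ∈ C, A x + A y - A (x + y) ∈ C)
    (hbound : BddAbove
      (Set.range fun x : {x : X // x ∈ C ∧ ‖x‖ = 1} => ‖A x.1‖)) :
    (∃ L : ℝ, 0 ≤ L ∧ ∀ x ∈ C, ∀ y ∈ C, ‖A x - A y‖ ≤ L * ‖x - y‖) ∧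
    List.TFAE
      [ EISS C A,
        ∃ r : ℝ, r < 1 ∧
          Filter.Tendsto
            (fun m : ℕ => (⨆ x : {x : X // x ∈ C ∧ ‖x‖ = 1}, ‖A^[m] x.1‖) ^ (1 / (m : ℝ)))
            Filter.atTop (nhds r),
        ∃ V : X → ℝ, ∃ L₁ L₂ ψ η : ℝ, 0 < L₁ ∧ 0 < L₂ ∧ 0 < ψ ∧ 1 < η ∧
          (∃ K : ℝ, 0 ≤ K ∧ ∀ x ∈ C, ∀ y ∈ C, |V x - V y| ≤ K * ‖x - y‖) ∧
          (∀ x ∈ C, L₁ * ‖x‖ ≤ V x ∧ V x ≤ L₂ * ‖x‖) ∧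
          (∀ u : ℕ → X, (∀ k, u k ∈ C) → BddAbove (Set.range fun k => ‖u k‖) →
            ∀ x : ℕ → X, (∀ k, x k ∈ C) →
              (∀ k, A (x k) + u k - x (k + 1) ∈ C) →
              ∀ k, V (x (k + 1)) ≤ η⁻¹ * V (x k) + ψ * (⨆ j, ‖u j‖)) ] := by
  obtain ⟨δ, hδ, hnorm⟩ := hnormal
  obtain ⟨κ, hκ, hdec⟩ := aux_gen C hclosed hadd hsmul hgen
  have h0 : (0 : X) ∈ C := by
    obtain ⟨y, hy, -⟩ := hgen 0
    simpa using hsmul 0 le_rfl y hy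
  -- transitivity
  have htr : ∀ x y z : X, y - x ∈ C → z - y ∈ C → z - x ∈ C := by
    intro x y z h1 h2
    have := hadd _ h2 _ h1
    rwa [sub_add_sub_cancel] at this
  -- iterates
  have itC : ∀ n, ∀ x ∈ C, A^[n] x ∈ C := by
    intro n
    induction n with
    | zero => intro x hx; simpa using hx
    | succ n ih => intro x hx; rw [Function.iterate_succ_apply']; exact hA _ (ih x hx)
  have itmono : ∀ n, ∀ x ∈ C, ∀ y ∈ C, y - x ∈ C → A^[n] y - A^[n] x ∈ C := by
    intro n
    induction n with
    | zero => intro x hx y hy h; simpa using h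
    | succ n ih =>
      intro x hx y hy h
      rw [Function.iterate_succ_apply', Function.iterate_succ_apply']
      exact hmono _ (itC n x hx) _ (itC n y hy) (ih x hx y hy h)
  have ithom : ∀ n, ∀ x ∈ C, ∀ r : ℝ, 0 ≤ r → A^[n] (r • x) = r • A^[n] x := by
    intro n
    induction n with
    | zero => intro x hx r hr; simp
    | succ n ih =>
      intro x hx r hr
      rw [Function.iterate_succ_apply', Function.iterate_succ_apply', ih x hx r hr,
        hhomog _ (itC n x hx) r hr]
  have itsub : ∀ n, ∀ x ∈ C, ∀ y ∈ C, A^[n] x + A^[n] y - A^[n] (x + y) ∈ C := by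
    intro n
    induction n with
    | zero => intro x hx y hy; simpa using h0
    | succ n ih =>
      intro x hx y hy
      simp only [Function.iterate_succ_apply']
      refine htr _ (A (A^[n] x + A^[n] y)) _ ?_ (hsubadd _ (itC n x hx) _ (itC n y hy))
      exact hmono _ (itC n _ (hadd x hx y hy)) _ (hadd _ (itC n x hx) _ (itC n y hy))
        (ih x hx y hy)
  obtain ⟨c, hc0, hc⟩ : ∃ c : ℝ, 0 ≤ c ∧ ∀ x ∈ C, ‖A x‖ ≤ c * ‖x‖ := by
    obtain ⟨c, hc⟩ := hbound
    refine ⟨max c 0, le_max_right _ _, fun x hx => ?_⟩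
    by_cases hx0 : x = 0
    · have := hhomog 0 h0 0 le_rfl
      simp only [zero_smul] at this
      simp [hx0, this]
    have hn : ‖x‖ ≠ 0 := norm_ne_zero_iff.mpr hx0
    have h1 : ‖A (‖x‖⁻¹ • x)‖ ≤ c := hc ⟨⟨‖x‖⁻¹ • x, hsmul _ (by positivity) x hx, by
      rw [norm_smul, norm_inv, norm_norm, inv_mul_cancel₀ hn]⟩, rfl⟩
    rw [hhomog x hx _ (by positivity), norm_smul, norm_inv, norm_norm,
      inv_mul_le_iff₀ (by positivity)] at h1
    calc ‖A x‖ ≤ ‖x‖ * c := h1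
      _ ≤ max c 0 * ‖x‖ := by rw [mul_comm]; gcongr; exact le_max_left _ _
  have itb : ∀ n, ∀ x ∈ C, ‖A^[n] x‖ ≤ c ^ n * ‖x‖ := by
    intro n
    induction n with
    | zero => intro x hx; simp
    | succ n ih =>
      intro x hx
      rw [Function.iterate_succ_apply']
      calc _ ≤ c * ‖A^[n] x‖ := hc _ (itC n x hx)
        _ ≤ c * (c ^ n * ‖x‖) := by gcongr; exact ih x hx
        _ = _ := by ring
  let s : ℕ → ℝ := fun m => ⨆ x : {x : X // x ∈ C ∧ ‖x‖ = 1}, ‖A^[m] x.1‖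
  have s0 : ∀ m, 0 ≤ s m := fun m => Real.iSup_nonneg fun _ => norm_nonneg _
  have sle : ∀ m b, 0 ≤ b → (∀ x ∈ C, ‖A^[m] x‖ ≤ b * ‖x‖) → s m ≤ b := by
    intro m b hb h
    refine Real.iSup_le (fun x => ?_) hb
    have := h x.1 x.2.1
    rwa [x.2.2, mul_one] at this
  have les : ∀ m, ∀ x ∈ C, ‖A^[m] x‖ ≤ s m * ‖x‖ := by
    intro m x hx
    by_cases hx0 : x = 0
    · have := itb m x hx
      simpa [hx0] using this
    have hn : ‖x‖ ≠ 0 := norm_ne_zero_iff.mpr hx0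
    have hbd : BddAbove (Set.range fun x : {x : X // x ∈ C ∧ ‖x‖ = 1} => ‖A^[m] x.1‖) := by
      refine ⟨c ^ m, ?_⟩
      rintro _ ⟨y, rfl⟩
      have := itb m y.1 y.2.1
      rwa [y.2.2, mul_one] at this
    have h1 : ‖A^[m] (‖x‖⁻¹ • x)‖ ≤ s m := le_ciSup hbd ⟨‖x‖⁻¹ • x,
      hsmul _ (by positivity) x hx, by
      rw [norm_smul, norm_inv, norm_norm, inv_mul_cancel₀ hn]⟩
    rw [ithom m x hx _ (by positivity), norm_smul, norm_inv, norm_norm,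
      inv_mul_le_iff₀ (by positivity), mul_comm] at h1
    exact h1
  have ssub : ∀ m n, s (m + n) ≤ s m * s n := by
    intro m n
    refine sle _ _ (mul_nonneg (s0 m) (s0 n)) fun x hx => ?_
    rw [Function.iterate_add_apply]
    calc _ ≤ s m * ‖A^[n] x‖ := les m _ (itC n x hx)
      _ ≤ s m * (s n * ‖x‖) := mul_le_mul_of_nonneg_left (les n x hx) (s0 m)
      _ = _ := by ring
  constructor
  · refine ⟨(2 * δ + 1) * c * κ, by positivity, fun x hx y hy => ?_⟩
    obtain ⟨p, hp, q, hq, hpq, hpn, hqn⟩ := hdec (x - y)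
    have h1 : A y + A p - A x ∈ C := by
      refine htr _ (A (y + p)) _ (hmono _ hx _ (hadd y hy p hp) ?_) (hsubadd y hy p hp)
      have : y + p - x = q := by
        rw [← sub_eq_zero]
        have := sub_eq_zero.mpr hpq
        rw [← neg_eq_zero, ← this]; abel
      rwa [this]
    have h2 : A x + A q - A y ∈ C := by
      refine htr _ (A (x + q)) _ (hmono _ hy _ (hadd x hx q hq) ?_) (hsubadd x hx q hq)
      have : x + q - y = p := by
        rw [← sub_eq_zero]
        have := sub_eq_zero.mpr hpq
        rw [← this]; abel
      rwa [this]
    have h3 : ‖A x + A q - A y‖ ≤ δ * ‖A p + A q‖ := by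
      refine hnorm _ _ h2 ?_
      convert h1 using 1
      abel
    have hpA := (hc p hp).trans (mul_le_mul_of_nonneg_left hpn hc0)
    have hqA := (hc q hq).trans (mul_le_mul_of_nonneg_left hqn hc0)
    have h4 : ‖A x - A y‖ ≤ ‖A x + A q - A y‖ + ‖A q‖ := by
      have : A x - A y = (A x + A q - A y) - A q := by abel
      rw [this]
      exact norm_sub_le _ _
    have h5 : ‖A p + A q‖ ≤ 2 * (c * (κ * ‖x - y‖)) := by
      linarith [norm_add_le (A p) (A q)]
    have h6 := mul_le_mul_of_nonneg_left h5 hδ.le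
    linarith
  have hd_of_a : EISS C A → ∃ M a : ℝ, 1 ≤ M ∧ 0 < a ∧ a < 1 ∧
      ∀ x ∈ C, ∀ k, ‖A^[k] x‖ ≤ M * a ^ k * ‖x‖ := by
    rintro ⟨M, hM, a, ha0, ha1, γ, hγ, h⟩
    refine ⟨M, a, hM, ha0, ha1, fun x hx k => ?_⟩
    have := h (fun _ => 0) (fun _ => h0) ⟨0, by rintro _ ⟨_, rfl⟩; simp⟩ (fun k => A^[k] x)
      (fun k => itC k x hx) (fun k => by
        simp only [Function.iterate_succ_apply', add_zero, sub_self]; exact h0) k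
    simp only [norm_zero, ciSup_const, hγ.1.2.2, add_zero, Function.iterate_zero, id] at this
    linarith
  tfae_have 1 → 2 := by
    intro h
    obtain ⟨M, a, hM, ha0, ha1, h⟩ := hd_of_a h
    have hlim : Tendsto (fun k : ℕ => M * a ^ k) atTop (𝓝 (M * 0)) :=
      (tendsto_pow_atTop_nhds_zero_of_lt_one ha0.le ha1).const_mul M
    rw [mul_zero] at hlim
    obtain ⟨N, hN1, hN⟩ := ((hlim.eventually_lt_const one_pos).and (eventually_ge_atTop 1)).exists
    exact aux_fekete s s0 ssub ⟨N, hN, (sle N _ (by positivity) fun x hx => h x hx N).trans_lt hN1⟩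
  tfae_have 2 → 3 := by
    rintro ⟨r, hr, hlim⟩
    obtain ⟨M, a, hM, ha0, ha1, h⟩ : ∃ M a : ℝ, 1 ≤ M ∧ 0 < a ∧ a < 1 ∧
      ∀ x ∈ C, ∀ k, ‖A^[k] x‖ ≤ M * a ^ k * ‖x‖ := by
      obtain ⟨a, har, ha1⟩ := exists_between (max_lt hr one_pos)
      have ha0 : 0 < a := (le_max_right _ _).trans_lt har
      obtain ⟨N, hN⟩ := eventually_atTop.mp
        (hlim.eventually_lt_const ((le_max_left _ _).trans_lt har))
      let M : ℝ := 1 + ∑ i ∈ Finset.range (N + 1), s i / a ^ i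
      have hs : 0 ≤ ∑ i ∈ Finset.range (N + 1), s i / a ^ i :=
          Finset.sum_nonneg fun i _ => div_nonneg (s0 i) (by positivity)
      have hM : 1 ≤ M := by simp only [M]; linarith
      refine ⟨M, a, hM, ha0, ha1, fun x hx k => ?_⟩
      refine (les k x hx).trans (mul_le_mul_of_nonneg_right ?_ (norm_nonneg _))
      by_cases hk : k < N + 1
      · have : s k / a ^ k ≤ M := by
          have := Finset.single_le_sum (f := fun i => s i / a ^ i)
            (fun i _ => div_nonneg (s0 i) (by positivity)) (Finset.mem_range.mpr hk)
          simp only [M]; linarith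
        rwa [div_le_iff₀ (by positivity)] at this
      · have hkN : N ≤ k := by omega
        have hk0 : (0 : ℝ) < k := by
          have : 0 < k := by omega
          exact_mod_cast this
        have h1 : s k ^ (1 / (k : ℝ)) < a := hN k hkN
        have := Real.rpow_le_rpow (Real.rpow_nonneg (s0 k) _) h1.le hk0.le
        rw [← Real.rpow_mul (s0 k), one_div, inv_mul_cancel₀ hk0.ne', Real.rpow_one,
          Real.rpow_natCast] at this
        have h2 : 0 < a ^ k := by positivity
        nlinarith
    -- monotone norm
    let p : X → ℝ := fun x => ⨅ y : {y : X // y - x ∈ C}, ‖y.1‖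
    have pne : ∀ x : X, Nonempty {y : X // y - x ∈ C} := fun x => ⟨⟨x, by simpa using h0⟩⟩
    have pbd : ∀ x : X, BddBelow (Set.range fun y : {y : X // y - x ∈ C} => ‖y.1‖) :=
      fun x => ⟨0, by rintro _ ⟨y, rfl⟩; exact norm_nonneg _⟩
    have p0 : ∀ x, 0 ≤ p x := fun x => Real.iInf_nonneg fun _ => norm_nonneg _
    have ple' : ∀ x y : X, y - x ∈ C → p x ≤ ‖y‖ := fun x y hxy => ciInf_le (pbd x) ⟨y, hxy⟩
    have ple : ∀ x, p x ≤ ‖x‖ := fun x => ple' x x (by simpa using h0)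
    have pge : ∀ x ∈ C, δ⁻¹ * ‖x‖ ≤ p x := by
      intro x hx
      haveI := pne x
      refine le_ciInf fun y => ?_
      rw [inv_mul_le_iff₀ hδ]
      exact hnorm x y.1 hx y.2
    have pmono : ∀ x y : X, y - x ∈ C → p x ≤ p y := by
      intro x y hxy
      haveI := pne y
      exact le_ciInf fun z => ple' x z.1 (htr _ _ _ hxy z.2)
    have padd : ∀ x y : X, p (x + y) ≤ p x + p y := by
      intro x y
      haveI := pne x
      haveI := pne y
      refine le_ciInf_add_ciInf fun z w => ?_
      refine (ple' _ (z.1 + w.1) ?_).trans (norm_add_le _ _)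
      convert hadd _ z.2 _ w.2 using 1
      abel
    let V : X → ℝ := fun x => ⨆ n : ℕ, a⁻¹ ^ n * p (A^[n] x)
    have tb : ∀ x ∈ C, ∀ n : ℕ, a⁻¹ ^ n * p (A^[n] x) ≤ M * ‖x‖ := by
      intro x hx n
      calc a⁻¹ ^ n * p (A^[n] x) ≤ a⁻¹ ^ n * (M * a ^ n * ‖x‖) := by
            gcongr
            exact (ple _).trans (h x hx n)
        _ = (a⁻¹ * a) ^ n * (M * ‖x‖) := by rw [mul_pow]; ring
        _ = M * ‖x‖ := by rw [inv_mul_cancel₀ ha0.ne', one_pow, one_mul]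
    have Vle : ∀ x ∈ C, V x ≤ M * ‖x‖ := fun x hx => ciSup_le (tb x hx)
    have Vge : ∀ x ∈ C, ∀ n : ℕ, a⁻¹ ^ n * p (A^[n] x) ≤ V x := fun x hx n =>
      le_ciSup (f := fun n : ℕ => a⁻¹ ^ n * p (A^[n] x))
        ⟨M * ‖x‖, by rintro _ ⟨n, rfl⟩; exact tb x hx n⟩ n
    have Vmono : ∀ x ∈ C, ∀ y ∈ C, y - x ∈ C → V x ≤ V y := by
      intro x hx y hy hxy
      refine ciSup_le fun n => le_trans ?_ (Vge y hy n)
      gcongr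
      exact pmono _ _ (itmono n x hx y hy hxy)
    have Vadd : ∀ x ∈ C, ∀ y ∈ C, V (x + y) ≤ V x + V y := by
      intro x hx y hy
      refine ciSup_le fun n => le_trans ?_ (add_le_add (Vge x hx n) (Vge y hy n))
      rw [← mul_add]
      gcongr
      exact (pmono _ _ (itsub n x hx y hy)).trans (padd _ _)
    have VA : ∀ x ∈ C, V (A x) ≤ a * V x := by
      intro x hx
      refine ciSup_le fun n => ?_
      have := mul_le_mul_of_nonneg_left (Vge x hx (n + 1)) ha0.le
      rw [pow_succ, Function.iterate_succ_apply] at this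
      calc _ = a * (a⁻¹ ^ n * a⁻¹ * p (A^[n] (A x))) := by
            field_simp
        _ ≤ _ := this
    have hMpos : 0 < M := by linarith
    have Vlip : ∀ x ∈ C, ∀ y ∈ C, V x - V y ≤ M * κ * ‖x - y‖ := by
      intro x hx y hy
      obtain ⟨p, hp, q, hq, hpq, hpn, hqn⟩ := hdec (x - y)
      have : y + p - x = q := by
        rw [← sub_eq_zero]
        have := sub_eq_zero.mpr hpq
        rw [← neg_eq_zero, ← this]; abel
      have h1 := Vmono x hx (y + p) (hadd y hy p hp) (by rwa [this])
      have h2 := Vadd y hy p hp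
      have h3 := Vle p hp
      have h4 := mul_le_mul_of_nonneg_left hpn hMpos.le
      linarith
    refine ⟨V, δ⁻¹, M, M, a⁻¹, by positivity, hMpos, hMpos, (one_lt_inv₀ ha0).mpr ha1,
      ⟨M * κ, by positivity, fun x hx y hy => ?_⟩, fun x hx => ⟨?_, Vle x hx⟩, ?_⟩
    · rw [abs_le]
      have h1 := Vlip x hx y hy
      have h2 := Vlip y hy x hx
      rw [norm_sub_rev] at h2
      constructor <;> linarith
    · have := Vge x hx 0
      simp only [pow_zero, one_mul, Function.iterate_zero, id] at this
      exact (pge x hx).trans this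
    · intro u hu hub x hx hxu k
      have hAx := hA _ (hx k)
      have h1 := Vmono _ (hx (k + 1)) _ (hadd _ hAx _ (hu k)) (hxu k)
      have h2 := Vadd _ hAx _ (hu k)
      have h3 := VA _ (hx k)
      have h4 := Vle _ (hu k)
      have h5 : ‖u k‖ ≤ ⨆ j, ‖u j‖ := le_ciSup hub k
      have h6 := mul_le_mul_of_nonneg_left h5 hMpos.le
      rw [inv_inv]
      linarith
  tfae_have 3 → 1 := by
    rintro ⟨V, L₁, L₂, ψ, η, hL₁, hL₂, hψ, hη, -, hV, hdiss⟩
    have hη0 : 0 < η := by linarith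
    have ha1 : η⁻¹ < 1 := inv_lt_one_of_one_lt₀ hη
    have ha0 : 0 < η⁻¹ := by positivity
    have hd : 0 < 1 - η⁻¹ := by linarith
    let g : ℝ := ψ / (1 - η⁻¹) / L₁
    have hg : 0 < g := by simp only [g]; positivity
    refine ⟨max 1 (L₂ / L₁), le_max_left _ _, η⁻¹, ha0, ha1, fun t => g * t, ⟨⟨?_, ?_, ?_⟩, ?_⟩, ?_⟩
    · fun_prop
    · intro x _ y _ hxy
      exact mul_lt_mul_of_pos_left hxy hg
    · simp
    · exact Tendsto.const_mul_atTop hg tendsto_id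
    · intro u hu hub x hx hxu k
      have hdk := hdiss u hu hub x hx hxu
      set U := ⨆ j, ‖u j‖ with hU
      have hU0 : 0 ≤ U := Real.iSup_nonneg fun _ => norm_nonneg _
      have key : ∀ k, V (x k) ≤ η⁻¹ ^ k * V (x 0) + ψ / (1 - η⁻¹) * U := by
        intro k
        induction k with
        | zero =>
          have : 0 ≤ ψ / (1 - η⁻¹) * U := by positivity
          simp only [pow_zero, one_mul]; linarith
        | succ k ih =>
          have h1 := mul_le_mul_of_nonneg_left ih ha0.le
          have h2 : ψ / (1 - η⁻¹) * U = η⁻¹ * (ψ / (1 - η⁻¹) * U) + ψ * U := by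
            have : ψ / (1 - η⁻¹) * (1 - η⁻¹) = ψ := div_mul_cancel₀ _ hd.ne'
            linear_combination (U) * this
          have h3 := hdk k
          rw [pow_succ']
          linarith
      have h1 := (hV _ (hx k)).1
      have h2 := (hV _ (hx 0)).2
      have h3 := key k
      have h4 := mul_le_mul_of_nonneg_left h2 (pow_nonneg ha0.le k)
      have h5 : ‖x k‖ ≤ (η⁻¹ ^ k * (L₂ * ‖x 0‖) + ψ / (1 - η⁻¹) * U) / L₁ := by
        rw [le_div_iff₀ hL₁]; linarith
      refine h5.trans ?_
      have h6 : (η⁻¹ ^ k * (L₂ * ‖x 0‖) + ψ / (1 - η⁻¹) * U) / L₁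
          = L₂ / L₁ * ‖x 0‖ * η⁻¹ ^ k + g * U := by
        simp only [g]; ring
      rw [h6]
      gcongr
      exact le_max_right _ _
  tfae_finish
end
end

section
/- Let I be a nonempty index set and γ_ij, (i,j) ∈ I×I, gains of class K ∪ {0} with sup_{i,j∈I} γ_ij(r) < ∞ for every r > 0, so that the gain operator Γ_⊗ : ℓ∞(I)⁺ → ℓ∞(I)⁺ is well-defined. Then for every n ∈ ℕ and every x ∈ ℓ∞(I)⁺, the n-th iterate of Γ_⊗ satisfies, componentwise for each i ∈ I: (Γ_⊗ⁿ(x))_i = sup_{j₂,…,j_{n+1} ∈ I} γ_{i j₂}(γ_{j₂ j₃}(⋯ γ_{j_n j_{n+1}}(x_{j_{n+1}}) ⋯)). -/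
open Filter Set

noncomputable section

/-- The composition of gains along a chain of indices:
`chainVal γ n i j r = γ_{i,j₀}(γ_{j₀,j₁}(⋯ γ_{j_{n-2},j_{n-1}}(r) ⋯))`. -/
def chainVal {I : Type*} (γ : I → I → ℝ → ℝ) : (n : ℕ) → I → (Fin n → I) → ℝ → ℝ
  | 0, _, _, r => r
  | n + 1, i, j, r => γ i (j 0) (chainVal γ n (j 0) (fun k => j k.succ) r)


lemma aux_cont {g : ℝ → ℝ} (h : IsClassK0 g) : ContinuousOn g (Set.Ici 0) := by
  rcases h with h | h
  · exact h.1
  · exact (continuousOn_const (c := (0:ℝ))).congr h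

lemma aux_mono {g : ℝ → ℝ} (h : IsClassK0 g) : MonotoneOn g (Set.Ici 0) := by
  rcases h with h | h
  · exact h.2.1.monotoneOn
  · intro a ha b hb _
    rw [h ha, h hb]; rfl

lemma aux_nonneg {g : ℝ → ℝ} (h : IsClassK0 g) {r : ℝ} (hr : 0 ≤ r) : 0 ≤ g r := by
  have h0 : g 0 = 0 := by
    rcases h with h | h
    · exact h.2.2
    · exact h (Set.mem_Ici.2 le_rfl)
  rw [← h0]
  exact aux_mono h (Set.mem_Ici.2 le_rfl) hr hr

lemma aux_chain {I : Type*} (γ : I → I → ℝ → ℝ) (hγ : ∀ i j, IsClassK0 (γ i j)) :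
    ∀ (n : ℕ) (i : I) (j : Fin n → I) (r : ℝ), 0 ≤ r → 0 ≤ chainVal γ n i j r
  | 0, _, _, _, hr => hr
  | n + 1, i, j, r, hr => aux_nonneg (hγ i (j 0)) (aux_chain γ hγ n (j 0) _ r hr)

lemma aux_bound_s16 {I : Type*} (γ : I → I → ℝ → ℝ) (hγ : ∀ i j, IsClassK0 (γ i j))
    (hwd : ∀ r : ℝ, 0 < r → BddAbove (Set.range fun p : I × I => γ p.1 p.2 r))
    (x : I → ℝ) (hx : InLinfPos x) : ∃ C, ∀ i j, γ i j (x j) ≤ C := by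
  obtain ⟨h0, M, hM⟩ := hx
  obtain ⟨C, hC⟩ := hwd (max M 1) (by positivity)
  refine ⟨C, fun i j => le_trans ?_ (hC ⟨(i, j), rfl⟩)⟩
  have h1 : x j ≤ max M 1 :=
    (le_abs_self _).trans ((hM ⟨j, rfl⟩).trans (le_max_left _ _))
  exact aux_mono (hγ i j) (h0 j) ((h0 j).trans h1) h1

lemma aux_lub {I : Type*} [Nonempty I] (γ : I → I → ℝ → ℝ) (hγ : ∀ i j, IsClassK0 (γ i j))
    (hwd : ∀ r : ℝ, 0 < r → BddAbove (Set.range fun p : I × I => γ p.1 p.2 r))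
    (x : I → ℝ) (hx : InLinfPos x) (i : I) :
    IsLUB (Set.range fun j => γ i j (x j)) (gainOpMax γ x i) := by
  obtain ⟨C, hC⟩ := aux_bound_s16 γ hγ hwd x hx
  exact isLUB_ciSup ⟨C, by rintro _ ⟨j, rfl⟩; exact hC i j⟩

lemma aux_pos {I : Type*} [Nonempty I] (γ : I → I → ℝ → ℝ) (hγ : ∀ i j, IsClassK0 (γ i j))
    (hwd : ∀ r : ℝ, 0 < r → BddAbove (Set.range fun p : I × I => γ p.1 p.2 r))
    (x : I → ℝ) (hx : InLinfPos x) : InLinfPos (gainOpMax γ x) := by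
  have h0 : ∀ i, 0 ≤ gainOpMax γ x i := fun i =>
    Real.iSup_nonneg fun j => aux_nonneg (hγ i j) (hx.1 j)
  obtain ⟨C, hC⟩ := aux_bound_s16 γ hγ hwd x hx
  refine ⟨h0, C, ?_⟩
  rintro _ ⟨i, rfl⟩
  simp only [abs_of_nonneg (h0 i)]
  exact ciSup_le fun j => hC i j

lemma aux_main {I : Type*} [Nonempty I] (γ : I → I → ℝ → ℝ)
    (hγ : ∀ i j, IsClassK0 (γ i j))
    (hwd : ∀ r : ℝ, 0 < r → BddAbove (Set.range fun p : I × I => γ p.1 p.2 r))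
    (x : I → ℝ) (hx : InLinfPos x) (m : ℕ) :
    InLinfPos ((gainOpMax γ)^[m + 1] x) ∧ ∀ i : I,
      IsLUB (Set.range fun j : Fin (m + 1) → I =>
        chainVal γ (m + 1) i j (x (j (Fin.last m)))) ((gainOpMax γ)^[m + 1] x i) := by
  induction m with
  | zero =>
    refine ⟨aux_pos γ hγ hwd x hx, fun i => ?_⟩
    convert aux_lub γ hγ hwd x hx i using 1
    ext y
    constructor
    · rintro ⟨j, rfl⟩
      exact ⟨j 0, rfl⟩
    · rintro ⟨k, rfl⟩
      exact ⟨fun _ => k, rfl⟩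
    rfl
  | succ m ih =>
    obtain ⟨hp, hl⟩ := ih
    rw [Function.iterate_succ_apply']
    refine ⟨aux_pos γ hγ hwd _ hp, fun i => ?_⟩
    have key := aux_lub γ hγ hwd _ hp i
    have hk : ∀ k, IsLUB (γ i k '' (Set.range fun j : Fin (m + 1) → I =>
        chainVal γ (m + 1) k j (x (j (Fin.last m))))) (γ i k ((gainOpMax γ)^[m + 1] x k)) := by
      intro k
      have hsub : (Set.range fun j : Fin (m + 1) → I =>
          chainVal γ (m + 1) k j (x (j (Fin.last m)))) ⊆ Set.Ici 0 := by
        rintro _ ⟨j, rfl⟩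
        exact aux_chain γ hγ _ _ _ _ (hx.1 _)
      exact (hl k).isLUB_of_tendsto ((aux_mono (hγ i k)).mono hsub) (Set.range_nonempty _)
        (((aux_cont (hγ i k)) _ (hp.1 k)).mono hsub)
    constructor
    · rintro _ ⟨j, rfl⟩
      exact ((hk (j 0)).1 ⟨_, ⟨fun k => j k.succ, rfl⟩, rfl⟩).trans (key.1 ⟨j 0, rfl⟩)
    · intro b hb
      apply key.2
      rintro _ ⟨k, rfl⟩
      apply (hk k).2
      rintro _ ⟨_, ⟨j, rfl⟩, rfl⟩
      exact hb ⟨Fin.cons k j, rfl⟩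

/-- For gains `γ_ij ∈ K ∪ {0}` with `sup_{i,j} γ_ij(r) < ∞` for all `r > 0`,
the `n`-th iterate of the gain operator `Γ_⊗` satisfies, componentwise,
`(Γ_⊗ⁿ(x))_i = sup_{j₂,…,j_{n+1}} γ_{i j₂}(γ_{j₂ j₃}(⋯ γ_{j_n j_{n+1}}(x_{j_{n+1}}) ⋯))`
for every `n ≥ 1` and every `x ∈ ℓ∞(I)⁺`. -/
theorem gainOpMax_iterate_formula
    {I : Type*} [Nonempty I] (γ : I → I → ℝ → ℝ)
    (hγ : ∀ i j, IsClassK0 (γ i j))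
    (hwd : ∀ r : ℝ, 0 < r → BddAbove (Set.range fun p : I × I => γ p.1 p.2 r)) :
    ∀ (m : ℕ) (x : I → ℝ), InLinfPos x → ∀ i : I,
      (gainOpMax γ)^[m + 1] x i =
        ⨆ j : Fin (m + 1) → I, chainVal γ (m + 1) i j (x (j (Fin.last m))) := by
  intro m x hx i
  exact ((aux_main γ hγ hwd x hx m).2 i).csSup_eq (Set.range_nonempty _) |>.symm
end
end

section
/- Let γ_ij, (i,j) ∈ ℕ×ℕ, be gains of class K ∪ {0} with sup_{i,j} γ_ij(r) < ∞ for every r > 0, so that the gain operator Γ_⊗ : ℓ∞(ℕ)⁺ → ℓ∞(ℕ)⁺ is well-defined. If Γ_⊗ satisfies the small-gain condition (Γ_⊗(x) ≱ x for all x ∈ ℓ∞(ℕ)⁺ \ {0}), then all cycles built from the gains are contractions; that is, for every finite path i₁, i₂, …, i_k with i₁ = i_k and every r > 0: γ_{i₁i₂}(γ_{i₂i₃}(⋯ γ_{i_{k−1}i_k}(r) ⋯)) < r. -/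
open Filter Set

noncomputable section

theorem aux_K0_nonneg {g : ℝ → ℝ} (h : IsClassK0 g) {a : ℝ} (ha : 0 ≤ a) : 0 ≤ g a := by
  rcases h with h | h
  · have := h.2.1.monotoneOn (Set.mem_Ici.2 le_rfl) (Set.mem_Ici.2 ha) ha
    rwa [h.2.2] at this
  · exact (h (Set.mem_Ici.2 ha)).ge

theorem aux_K0_mono {g : ℝ → ℝ} (h : IsClassK0 g) {a b : ℝ} (ha : 0 ≤ a) (hab : a ≤ b) :
    g a ≤ g b := by
  rcases h with h | h
  · exact h.2.1.monotoneOn (Set.mem_Ici.2 ha) (Set.mem_Ici.2 (ha.trans hab)) hab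
  · rw [h (Set.mem_Ici.2 ha), h (Set.mem_Ici.2 (ha.trans hab))]; simp

theorem aux_chain_s17 (γ : ℕ → ℕ → ℝ → ℝ) (hγ : ∀ i j, IsClassK0 (γ i j)) (r : ℝ) (hr : 0 ≤ r) :
    ∀ (n : ℕ) (q : Fin (n + 1) → ℕ), ∃ v : Fin (n + 1) → ℝ, v (Fin.last n) = r ∧
      v 0 = chainVal γ n (q 0) (fun t => q t.succ) r ∧
      (∀ t : Fin n, v t.castSucc = γ (q t.castSucc) (q t.succ) (v t.succ)) ∧ ∀ t, 0 ≤ v t := by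
  intro n
  induction n with
  | zero => intro q; exact ⟨fun _ => r, rfl, rfl, fun t => t.elim0, fun _ => hr⟩
  | succ n ih =>
    intro q
    obtain ⟨v, h1, h2, h3, h4⟩ := ih (fun t => q t.succ)
    refine ⟨Fin.cons (γ (q 0) (q 1) (v 0)) v, ?_, ?_, ?_, ?_⟩
    · rw [← Fin.succ_last, Fin.cons_succ, h1]
    · rw [Fin.cons_zero, h2]; rfl
    · intro t
      refine Fin.cases ?_ (fun t => ?_) t
      · simp
      · rw [← Fin.succ_castSucc, Fin.cons_succ, Fin.cons_succ, h3]
    · intro t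
      refine Fin.cases ?_ (fun t => ?_) t
      · rw [Fin.cons_zero]; exact aux_K0_nonneg (hγ _ _) (h4 0)
      · rw [Fin.cons_succ]; exact h4 t

/-- If the gain operator `Γ_⊗` built from gains `γ_ij ∈ K ∪ {0}` on `ℕ`
satisfies the small-gain condition (`Γ_⊗(x) ≱ x` for all nonzero `x ∈ ℓ∞(ℕ)⁺`), then
all cycles built from the gains are contractions: for every path `i₁,…,i_k` with
`i₁ = i_k` and every `r > 0`, `γ_{i₁i₂}(γ_{i₂i₃}(⋯ γ_{i_{k−1}i_k}(r) ⋯)) < r`. -/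
theorem cycles_are_contractions_of_small_gain
    (γ : ℕ → ℕ → ℝ → ℝ)
    (hγ : ∀ i j, IsClassK0 (γ i j))
    (hwd : ∀ r : ℝ, 0 < r → BddAbove (Set.range fun p : ℕ × ℕ => γ p.1 p.2 r))
    (hsgc : ∀ x : ℕ → ℝ, InLinfPos x → x ≠ 0 → ¬ ∀ i, x i ≤ gainOpMax γ x i) :
    ∀ k : ℕ, 1 ≤ k → ∀ p : Fin (k + 1) → ℕ, p 0 = p (Fin.last k) →
      ∀ r : ℝ, 0 < r → chainVal γ k (p 0) (fun t => p t.succ) r < r := by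
  intro k hk p hp r hr
  by_contra hcon
  rw [not_lt] at hcon
  obtain ⟨v, h1, h2, h3, h4⟩ := aux_chain_s17 γ hγ r hr.le k p
  rw [← h2] at hcon
  set x : ℕ → ℝ := fun i => ⨆ t : Fin (k + 1), if p t = i then v t else 0 with hx
  have hbd : ∀ i, BddAbove (Set.range fun t : Fin (k + 1) => if p t = i then v t else 0) :=
    fun i => Set.Finite.bddAbove (Set.finite_range _)
  have hvx : ∀ t, v t ≤ x (p t) := fun t => by
    have := le_ciSup (hbd (p t)) t
    simpa using this
  have hx0 : ∀ i, 0 ≤ x i := fun i => Real.iSup_nonneg fun t => by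
    split_ifs
    · exact h4 t
    · exact le_rfl
  have hM : ∀ i, x i ≤ ∑ t, v t := fun i => ciSup_le fun t => by
    split_ifs
    · exact Finset.single_le_sum (f := v) (fun t _ => h4 t) (Finset.mem_univ t)
    · exact Finset.sum_nonneg fun t _ => h4 t
  have hxr : r ≤ x (p (Fin.last k)) := h1 ▸ hvx (Fin.last k)
  have hMpos : 0 < ∑ t, v t := hr.trans_le (hxr.trans (hM _))
  have hg0 : ∀ i, 0 ≤ gainOpMax γ x i := fun i =>
    Real.iSup_nonneg fun j => aux_K0_nonneg (hγ i j) (hx0 j)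
  have hgle : ∀ i j, γ i j (x j) ≤ gainOpMax γ x i := fun i j => by
    obtain ⟨B, hB⟩ := hwd _ hMpos
    refine le_ciSup (f := fun j => γ i j (x j)) ⟨B, ?_⟩ j
    rintro _ ⟨j, rfl⟩
    exact (aux_K0_mono (hγ i j) (hx0 j) (hM j)).trans (hB ⟨(i, j), rfl⟩)
  have hstep : ∀ t : Fin k, v t.castSucc ≤ gainOpMax γ x (p t.castSucc) := fun t => by
    rw [h3]
    exact (aux_K0_mono (hγ _ _) (h4 _) (hvx _)).trans (hgle _ _)
  refine hsgc x ⟨hx0, ∑ t, v t, ?_⟩ ?_ ?_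
  · rintro _ ⟨i, rfl⟩
    simpa only [abs_of_nonneg (hx0 i)] using hM i
  · intro h
    rw [h] at hxr
    exact absurd hr (not_lt.2 hxr)
  · intro i
    refine ciSup_le fun t => ?_
    split_ifs with hti
    · subst hti
      refine Fin.lastCases ?_ (fun t => hstep t) t
      rw [h1, ← hp]
      have := hstep ⟨0, hk⟩
      exact hcon.trans this
    · exact hg0 i
end
end
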